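/- arXiv:1105.4773 — 3 statements merged into one kernel-verified Lean document; each statement's English description precedes it below -/
import Mathlib

section
/- Let m ≥ 1 and let Δ ⊂ ℝ^m be an integral polytope, i.e. the convex hull of a finite subset of ℤ^m, and assume Δ has nonempty interior. Then there exists a polynomial E with real coefficients, of degree m, whose leading coefficient equals the Lebesgue volume Vol(Δ), with E(0) = 1, and such that for every natural number i, E(i) equals the number of lattice points of ℤ^m contained in the dilated polytope iΔ = {i·x : x ∈ Δ}. -/
open Pointwise MeasureTheory

section Cones

variable {ι E : Type*}

/-- The cone of nonnegative combinations of the vectors `w i`, `i ∈ I`. -/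
def closedCone [AddCommGroup E] [Module ℝ E] (w : ι → E) (I : Finset ι) : Set E :=
  {x | ∃ c : ι → ℝ, (∀ i ∈ I, 0 ≤ c i) ∧ ∑ i ∈ I, c i • w i = x}

/-- The cone of strictly positive combinations of the vectors `w i`, `i ∈ I`. -/
def openCone [AddCommGroup E] [Module ℝ E] (w : ι → E) (I : Finset ι) : Set E :=
  {x | ∃ c : ι → ℝ, (∀ i ∈ I, 0 < c i) ∧ ∑ i ∈ I, c i • w i = x}

section Module

variable [AddCommGroup E] [Module ℝ E] {w : ι → E} {I J : Finset ι} {x y : E}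

lemma closedCone_add (hx : x ∈ closedCone w I) (hy : y ∈ closedCone w I) :
    x + y ∈ closedCone w I := by
  obtain ⟨c, hc, rfl⟩ := hx
  obtain ⟨d, hd, rfl⟩ := hy
  exact ⟨c + d, fun i hi => add_nonneg (hc i hi) (hd i hi), by
    simp [add_smul, Finset.sum_add_distrib]⟩

lemma closedCone_smul {t : ℝ} (ht : 0 ≤ t) (hx : x ∈ closedCone w I) :
    t • x ∈ closedCone w I := by
  obtain ⟨c, hc, rfl⟩ := hx
  exact ⟨fun i => t * c i, fun i hi => mul_nonneg ht (hc i hi), by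
    simp [mul_smul, Finset.smul_sum]⟩

lemma openCone_add (hx : x ∈ openCone w I) (hy : y ∈ openCone w I) :
    x + y ∈ openCone w I := by
  obtain ⟨c, hc, rfl⟩ := hx
  obtain ⟨d, hd, rfl⟩ := hy
  exact ⟨c + d, fun i hi => add_pos (hc i hi) (hd i hi), by
    simp [add_smul, Finset.sum_add_distrib]⟩

lemma openCone_smul {t : ℝ} (ht : 0 < t) (hx : x ∈ openCone w I) :
    t • x ∈ openCone w I := by
  obtain ⟨c, hc, rfl⟩ := hx
  exact ⟨fun i => t * c i, fun i hi => mul_pos ht (hc i hi), by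
    simp [mul_smul, Finset.smul_sum]⟩

lemma convex_openCone : Convex ℝ (openCone w I) :=
  convex_iff_forall_pos.2 fun _ hx _ hy _ _ ha hb _ =>
    openCone_add (openCone_smul ha hx) (openCone_smul hb hy)

lemma closedCone_mono (h : I ⊆ J) : closedCone w I ⊆ closedCone w J := by
  classical
  rintro x ⟨c, hc, rfl⟩
  refine ⟨fun i => if i ∈ I then c i else 0, fun i _ => ?_, ?_⟩
  · dsimp only
    split_ifs with hi
    exacts [hc i hi, le_rfl]
  · simp only [ite_smul, zero_smul, ← Finset.sum_filter]
    rw [Finset.filter_mem_eq_inter, Finset.inter_eq_right.2 h]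

lemma openCone_subset_closedCone (h : I ⊆ J) : openCone w I ⊆ closedCone w J :=
  fun _ ⟨c, hc, hx⟩ => closedCone_mono h ⟨c, fun i hi => (hc i hi).le, hx⟩

lemma exists_sub_smul_mem_closedCone (hx : x ∈ openCone w I) (hy : y ∈ openCone w I) :
    ∃ t : ℝ, 0 < t ∧ y - t • x ∈ closedCone w I := by
  obtain ⟨c, hc, rfl⟩ := hx
  obtain ⟨d, hd, rfl⟩ := hy
  obtain ⟨t, ht, h⟩ : ∃ t : ℝ, 0 < t ∧ ∀ i ∈ I, t * c i ≤ d i := by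
    have : ∀ᶠ t in nhdsWithin (0 : ℝ) (Set.Ioi 0), ∀ i ∈ I, t * c i ≤ d i := by
      refine (Filter.eventually_all_finset I).2 fun i hi => ?_
      have : Filter.Tendsto (fun t : ℝ => t * c i) (nhdsWithin 0 (Set.Ioi 0)) (nhds (0 * c i)) :=
        ((continuous_id.mul continuous_const).tendsto 0).mono_left nhdsWithin_le_nhds
      rw [zero_mul] at this
      exact (this.eventually_lt_const (hd i hi)).mono fun _ h => h.le
    obtain ⟨t, h1, h2⟩ := (this.and self_mem_nhdsWithin).exists
    exact ⟨t, h2, h1⟩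
  exact ⟨t, ht, fun i => d i - t * c i, fun i hi => sub_nonneg.2 (h i hi), by
    simp [sub_smul, mul_smul, Finset.smul_sum]⟩

/-- Whether one can move from a point of an open cone in the direction `v` inside a larger cone
does not depend on the point. -/
lemma exists_add_smul_mem_closedCone (hIJ : I ⊆ J) {v : E} (hx : x ∈ openCone w I)
    (hy : y ∈ openCone w I) (h : ∃ s : ℝ, 0 < s ∧ x + s • v ∈ closedCone w J) :
    ∃ s : ℝ, 0 < s ∧ y + s • v ∈ closedCone w J := by
  obtain ⟨s, hs, h⟩ := h
  obtain ⟨t, ht, h1⟩ := exists_sub_smul_mem_closedCone hx hy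
  refine ⟨t * s, mul_pos ht hs, ?_⟩
  have : y + (t * s) • v = (y - t • x) + t • (x + s • v) := by module
  exact this ▸ closedCone_add (closedCone_mono hIJ h1) (closedCone_smul ht.le h)

lemma add_smul_mem_closedCone_of_le {v : E} {s t : ℝ} (hx : x ∈ closedCone w I)
    (hs : 0 < s) (hst : s ≤ t) (h : x + t • v ∈ closedCone w I) : x + s • v ∈ closedCone w I := by
  have ht : 0 < t := hs.trans_le hst
  have : x + s • v = (1 - s / t) • x + (s / t) • (x + t • v) := by
    have : s = s / t * t := by field_simp
    rw [smul_add, smul_smul, ← this]; module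
  rw [this]
  exact closedCone_add (closedCone_smul (sub_nonneg.2 ((div_le_one ht).2 hst)) hx)
    (closedCone_smul (by positivity) h)

lemma mem_openCone_insert [DecidableEq ι] {a : ι} (ha : a ∉ I) :
    x ∈ openCone w (insert a I) ↔ ∃ y ∈ openCone w I, ∃ s : ℝ, 0 < s ∧ x = y + s • w a := by
  constructor
  · rintro ⟨c, hc, rfl⟩
    exact ⟨_, ⟨c, fun i hi => hc i (Finset.mem_insert_of_mem hi), rfl⟩, c a,
      hc a (Finset.mem_insert_self _ _), by rw [Finset.sum_insert ha, add_comm]⟩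
  · rintro ⟨y, ⟨c, hc, rfl⟩, s, hs, rfl⟩
    refine ⟨fun i => if i = a then s else c i, fun i hi => ?_, ?_⟩
    · dsimp only
      split_ifs with h
      · exact hs
      · exact hc i (Finset.mem_of_mem_insert_of_ne hi h)
    · rw [Finset.sum_insert ha, add_comm]
      congr 1
      · exact Finset.sum_congr rfl fun i hi => by simp [ne_of_mem_of_not_mem hi ha]
      · simp

lemma exists_add_smul_mem_openCone {v : E} (hv : v ∈ Submodule.span ℝ (w '' I)) :
    ∃ y ∈ openCone w I, ∃ s : ℝ, 0 < s ∧ y + s • v ∈ openCone w I := by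
  obtain ⟨d, rfl⟩ := Submodule.mem_span_image_finset_iff_exists_fun' (R := ℝ) |>.1 hv
  refine ⟨_, ⟨fun i => 1 + |d i|, fun i _ => by positivity, rfl⟩, 1, one_pos,
    fun i => (1 + |d i|) + d i, fun i _ => by linarith [neg_abs_le (d i)], ?_⟩
  simp only [add_smul, Finset.sum_add_distrib, one_smul]

end Module

variable [NormedAddCommGroup E] [NormedSpace ℝ E] {w : ι → E}

/-- The amount of `w a` in a nonnegative representation attains its minimum. -/
lemma exists_min_coeff [DecidableEq ι] {h : E →ₗ[ℝ] ℝ} (hw : ∀ i, h (w i) = 1) {a : ι}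
    {W : Finset ι} (ha : a ∉ W) {x : E} (hx : x ∈ closedCone w (insert a W)) :
    ∃ t : ℝ, 0 ≤ t ∧ x - t • w a ∈ closedCone w W ∧
      ∀ s : ℝ, 0 ≤ s → x - s • w a ∈ closedCone w W → t ≤ s := by
  let K : Set (↥(insert a W) → ℝ) := {c | (∀ i, 0 ≤ c i) ∧ ∑ i, c i • w i = x}
  have hKc : IsCompact K := by
    refine Metric.isCompact_of_isClosed_isBounded ?_ ?_
    · exact (isClosed_Ici (a := (0 : ↥(insert a W) → ℝ))).inter
        (isClosed_eq (f := fun c : ↥(insert a W) → ℝ => ∑ i, c i • w i) (by fun_prop) continuous_const)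
    · refine (Metric.isBounded_Icc (0 : ↥(insert a W) → ℝ) (fun _ => h x)).subset ?_
      rintro c ⟨hc, rfl⟩
      refine ⟨hc, fun i => ?_⟩
      simp only [map_sum, map_smul, hw, smul_eq_mul, mul_one]
      exact Finset.single_le_sum (fun j _ => hc j) (Finset.mem_univ i)
  have key : ∀ s : ℝ, 0 ≤ s → x - s • w a ∈ closedCone w W →
      ∃ c ∈ K, c ⟨a, Finset.mem_insert_self _ _⟩ = s := by
    rintro s hs ⟨c, hc, hcx⟩
    refine ⟨fun i => if (i : ι) = a then s else c i, ⟨fun i => ?_, ?_⟩, by simp⟩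
    · dsimp only
      split_ifs with h
      · exact hs
      · exact hc i (Finset.mem_of_mem_insert_of_ne i.2 h)
    · rw [Finset.sum_coe_sort (insert a W) (fun i => (if i = a then s else c i) • w i),
        Finset.sum_insert ha, if_pos rfl, Finset.sum_congr rfl
        (fun i hi => by rw [if_neg (ne_of_mem_of_not_mem hi ha)]), hcx]
      abel
  have hne : K.Nonempty := by
    obtain ⟨c, hc, hcx⟩ := hx
    exact ⟨fun i => c i, fun i => hc i i.2, by
      rw [Finset.sum_coe_sort (insert a W) (fun i => c i • w i), hcx]⟩
  obtain ⟨c, hcK, hmin⟩ := hKc.exists_isMinOn hne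
    (f := fun c => c ⟨a, Finset.mem_insert_self _ _⟩) (by fun_prop)
  refine ⟨c ⟨a, Finset.mem_insert_self _ _⟩, hcK.1 _, ?_, fun s hs hsx => ?_⟩
  · let c' : ι → ℝ := fun i => if hi : i ∈ insert a W then c ⟨i, hi⟩ else 0
    have hc' : ∀ i : ↥(insert a W), c' i = c i := fun i => dif_pos i.2
    have hsum : ∑ i ∈ insert a W, c' i • w i = x := by
      rw [← hcK.2, ← Finset.sum_coe_sort]
      exact Finset.sum_congr rfl fun i _ => by rw [hc']
    refine ⟨c', fun i hi => ?_, ?_⟩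
    · rw [hc' ⟨i, Finset.mem_insert_of_mem hi⟩]
      exact hcK.1 _
    · rw [Finset.sum_insert ha, hc' ⟨a, Finset.mem_insert_self _ _⟩] at hsum
      rw [← hsum]; abel
  · obtain ⟨d, hd, rfl⟩ := key s hs hsx
    exact hmin hd

/-- A placing triangulation: a cone generated by vectors of height one is a disjoint union of
simplicial open cones spanned by some of the generators. -/
lemma exists_openCone_decomposition [DecidableEq ι] {h : E →ₗ[ℝ] ℝ} (hw : ∀ i, h (w i) = 1)
    (W : Finset ι) :
    ∃ G : Finset (Finset ι), (∀ I ∈ G, I ⊆ W ∧ LinearIndepOn ℝ w (I : Set ι)) ∧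
      ∀ x ∈ closedCone w W, ∃! I, I ∈ G ∧ x ∈ openCone w I := by
  classical
  induction W using Finset.induction_on with
  | empty =>
    refine ⟨{∅}, by simp, fun x hx => ⟨∅, ⟨by simp, ?_⟩, by simp⟩⟩
    obtain ⟨c, hc, rfl⟩ := hx
    exact ⟨c, by simp, rfl⟩
  | insert a W ha ih =>
    obtain ⟨G, hG, hdec⟩ := ih
    let good : Finset ι → Prop := fun I =>
      ∀ y ∈ openCone w I, ∀ s : ℝ, 0 < s → y + s • w a ∉ closedCone w W
    have haI : ∀ I ∈ G, a ∉ I := fun I hI h => ha ((hG I hI).1 h)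
    have hsub : ∀ I ∈ G, openCone w I ⊆ closedCone w W := fun I hI =>
      openCone_subset_closedCone (hG I hI).1
    refine ⟨G ∪ (G.filter good).image (insert a), fun J hJ => ?_, fun x hx => ?_⟩
    · rcases Finset.mem_union.1 hJ with hJ | hJ
      · exact ⟨(hG J hJ).1.trans (Finset.subset_insert _ _), (hG J hJ).2⟩
      · obtain ⟨I, hI, rfl⟩ := Finset.mem_image.1 hJ
        obtain ⟨hI, hgood⟩ := Finset.mem_filter.1 hI
        refine ⟨Finset.insert_subset_insert _ (hG I hI).1, ?_⟩
        rw [Finset.coe_insert]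
        refine (hG I hI).2.insert fun hspan => ?_
        obtain ⟨y, hy, s, hs, hys⟩ := exists_add_smul_mem_openCone hspan
        exact hgood y hy s hs (hsub I hI hys)
    · have hnot : ∀ I ∈ G, good I → x ∈ openCone w (insert a I) → x ∉ closedCone w W := by
        intro I hI hgood hxI hxW
        obtain ⟨y, hy, s, hs, rfl⟩ := (mem_openCone_insert (haI I hI)).1 hxI
        exact hgood y hy s hs hxW
      have hexists : ∃ J, J ∈ G ∪ (G.filter good).image (insert a) ∧ x ∈ openCone w J := by
        obtain ⟨t, ht, hxt, hmin⟩ := exists_min_coeff hw ha hx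
        obtain ⟨I, ⟨hI, hxI⟩, -⟩ := hdec _ hxt
        rcases ht.eq_or_lt with rfl | ht
        · exact ⟨I, Finset.mem_union_left _ hI, by simpa using hxI⟩
        · refine ⟨insert a I, Finset.mem_union_right _ (Finset.mem_image_of_mem _
            (Finset.mem_filter.2 ⟨hI, fun y hy s hs hys => ?_⟩)),
            (mem_openCone_insert (haI I hI)).2 ⟨_, hxI, t, ht, by abel⟩⟩
          obtain ⟨r, hr, hxr⟩ := exists_add_smul_mem_closedCone (hG I hI).1 hy hxI ⟨s, hs, hys⟩
          have hmt : 0 < min r t := lt_min hr ht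
          have := add_smul_mem_closedCone_of_le hxt hmt (min_le_left r t) hxr
          have := hmin (t - min r t) (sub_nonneg.2 (min_le_right r t)) (by
            convert this using 1; module)
          linarith
      obtain ⟨J, hJ, hxJ⟩ := hexists
      refine ⟨J, ⟨hJ, hxJ⟩, fun J' ⟨hJ', hxJ'⟩ => ?_⟩
      rcases Finset.mem_union.1 hJ with hJ | hJ <;> rcases Finset.mem_union.1 hJ' with hJ' | hJ'
      · exact (hdec x (hsub J hJ hxJ)).unique ⟨hJ', hxJ'⟩ ⟨hJ, hxJ⟩
      · obtain ⟨I, hI, rfl⟩ := Finset.mem_image.1 hJ'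
        obtain ⟨hI, hgood⟩ := Finset.mem_filter.1 hI
        exact absurd (hsub J hJ hxJ) (hnot I hI hgood hxJ')
      · obtain ⟨I, hI, rfl⟩ := Finset.mem_image.1 hJ
        obtain ⟨hI, hgood⟩ := Finset.mem_filter.1 hI
        exact absurd (hsub J' hJ' hxJ') (hnot I hI hgood hxJ)
      · obtain ⟨I, hI, rfl⟩ := Finset.mem_image.1 hJ
        obtain ⟨hI, hgood⟩ := Finset.mem_filter.1 hI
        obtain ⟨I', hI', rfl⟩ := Finset.mem_image.1 hJ'
        obtain ⟨hI', hgood'⟩ := Finset.mem_filter.1 hI'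
        obtain ⟨y, hy, s, hs, hxy⟩ := (mem_openCone_insert (haI I hI)).1 hxJ
        obtain ⟨y', hy', s', hs', hxy'⟩ := (mem_openCone_insert (haI I' hI')).1 hxJ'
        have hyy : y = y' + (s' - s) • w a := by
          rw [sub_smul, ← add_sub_assoc, ← hxy', hxy]; abel
        rcases lt_trichotomy s s' with hlt | rfl | hlt
        · exact absurd (hyy ▸ hsub I hI hy) (hgood' y' hy' _ (sub_pos.2 hlt))
        · rw [sub_self, zero_smul, add_zero] at hyy
          subst hyy
          rw [(hdec y (hsub I hI hy)).unique ⟨hI', hy'⟩ ⟨hI, hy⟩]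
        · have hyy' : y' = y + (s - s') • w a := by rw [hyy]; module
          exact absurd (hyy' ▸ hsub I' hI' hy') (hgood y hy _ (sub_pos.2 hlt))

end Cones

section HalfOpenSimplices

open Polynomial in
lemma exists_polynomial_eval_eq_choose (a b : ℕ) :
    ∃ P : ℝ[X], ∀ n : ℕ, P.eval (n : ℝ) = ((n + a).choose b : ℝ) :=
  ⟨((b.factorial : ℝ)⁻¹) • (descPochhammer ℝ b).comp (X + C (a : ℝ)), fun n => by
    rw [Nat.cast_choose_eq_descPochhammer_div]
    simp [div_eq_inv_mul]⟩

lemma card_piAntidiag_nat {κ : Type*} [DecidableEq κ] (s : Finset κ) (n : ℕ) :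
    (s.piAntidiag n).card = (s.card + n - 1).choose n := by
  rw [← Finset.card_finsuppAntidiag_nat_eq_choose]
  simp [Finset.finsuppAntidiag]

/-- The lattice points of a half-open standard simplex, not all of whose facets are removed, are
counted by a polynomial on all dilations, including the zeroth one. -/
lemma exists_polynomial_halfOpen {κ : Type*} [Fintype κ] (D : AddSubgroup (κ → ℝ))
    (hZ : ∀ f : κ → ℤ, (fun i => (f i : ℝ)) ∈ D)
    (hsum : ∀ c ∈ D, ∃ z : ℤ, ∑ i, c i = z)
    (hfin : {c | c ∈ D ∧ ∀ i, 0 ≤ c i ∧ c i ≤ 1}.Finite)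
    (A : Set κ) (hA : ∃ i, i ∉ A) :
    ∃ P : Polynomial ℝ, ∀ n : ℕ, P.eval (n : ℝ) =
      Set.ncard {c | c ∈ D ∧ (∀ i, 0 ≤ c i ∧ (i ∈ A → 0 < c i)) ∧ ∑ i, c i = n} := by
  classical
  let B : Set (κ → ℝ) := {c | c ∈ D ∧ ∀ i, (i ∈ A → 0 < c i ∧ c i ≤ 1) ∧ (i ∉ A → 0 ≤ c i ∧ c i < 1)}
  have hB01 : ∀ c ∈ B, ∀ i, 0 ≤ c i ∧ c i ≤ 1 := fun c hc i => by
    by_cases hi : i ∈ A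
    · exact ⟨((hc.2 i).1 hi).1.le, ((hc.2 i).1 hi).2⟩
    · exact ⟨((hc.2 i).2 hi).1, ((hc.2 i).2 hi).2.le⟩
  have hB : B.Finite := hfin.subset fun c hc => ⟨hc.1, hB01 c hc⟩
  obtain ⟨i₀, hi₀⟩ := hA
  have hh : ∀ c ∈ B, ∃ k : ℕ, ∑ i, c i = k ∧ k + 1 ≤ Fintype.card κ := by
    intro c hc
    obtain ⟨z, hz⟩ := hsum c hc.1
    have h0 : 0 ≤ ∑ i, c i := Finset.sum_nonneg fun i _ => (hB01 c hc i).1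
    have h1 : ∑ i, c i < ∑ _i : κ, (1 : ℝ) := Finset.sum_lt_sum (fun i _ => (hB01 c hc i).2)
      ⟨i₀, Finset.mem_univ _, ((hc.2 i₀).2 hi₀).2⟩
    rw [hz] at h0 h1
    simp only [Finset.sum_const, Finset.card_univ, nsmul_eq_mul, mul_one] at h1
    lift z to ℕ using (by exact_mod_cast h0)
    exact ⟨z, by exact_mod_cast hz, by exact_mod_cast h1⟩
  choose! ht hht hhle using hh
  have hP := fun c : κ → ℝ =>
    exists_polynomial_eval_eq_choose (Fintype.card κ - 1 - ht c) (Fintype.card κ - 1)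
  choose P hP using hP
  refine ⟨∑ c ∈ hB.toFinset, P c, fun n => ?_⟩
  let T : Finset (Σ _ : κ → ℝ, κ → ℕ) := hB.toFinset.sigma fun c =>
    if ht c ≤ n then Finset.univ.piAntidiag (n - ht c) else ∅
  have hT : {c | c ∈ D ∧ (∀ i, 0 ≤ c i ∧ (i ∈ A → 0 < c i)) ∧ ∑ i, c i = n} =
      (fun p : Σ _ : κ → ℝ, κ → ℕ => p.1 + fun i => (p.2 i : ℝ)) '' (T : Set _) := by
    ext c
    constructor
    · rintro ⟨hcD, hc, hcn⟩
      let f : κ → ℕ := fun i => if i ∈ A then ⌈c i⌉₊ - 1 else ⌊c i⌋₊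
      have hfA : ∀ i ∈ A, (f i : ℝ) < c i ∧ c i ≤ f i + 1 := by
        intro i hi
        have hpos : 0 < ⌈c i⌉₊ := Nat.ceil_pos.2 ((hc i).2 hi)
        have h1 : (f i : ℝ) = (⌈c i⌉₊ : ℝ) - 1 := by
          simp only [f, if_pos hi]; rw [Nat.cast_sub hpos, Nat.cast_one]
        have := Nat.ceil_lt_add_one (hc i).1
        have := Nat.le_ceil (c i)
        constructor <;> linarith
      have hfA' : ∀ i ∉ A, (f i : ℝ) ≤ c i ∧ c i < f i + 1 := by
        intro i hi
        simp only [f, if_neg hi]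
        exact ⟨Nat.floor_le (hc i).1, Nat.lt_floor_add_one _⟩
      have hpB : (c - fun i => (f i : ℝ)) ∈ B := by
        refine ⟨D.sub_mem hcD (by simpa using hZ fun i => f i), fun i => ⟨fun hi => ?_, fun hi => ?_⟩⟩
        · have := hfA i hi
          constructor <;> simp only [Pi.sub_apply] <;> linarith
        · have := hfA' i hi
          constructor <;> simp only [Pi.sub_apply] <;> linarith
      have hs : (ht (c - fun i => (f i : ℝ)) : ℝ) + ((∑ i, f i : ℕ) : ℝ) = n := by
        rw [← hht _ hpB, ← hcn]
        simp
      have hs' : ht (c - fun i => (f i : ℝ)) + ∑ i, f i = n := by exact_mod_cast hs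
      refine ⟨⟨c - fun i => (f i : ℝ), f⟩, ?_, by simp⟩
      simp only [T, Finset.coe_sigma, Set.mem_sigma_iff, Finset.mem_coe, Set.Finite.mem_toFinset]
      refine ⟨hpB, ?_⟩
      rw [if_pos (by omega), Finset.mem_piAntidiag]
      exact ⟨(Nat.sub_eq_of_eq_add' hs'.symm).symm, by simp⟩
    · rintro ⟨⟨p, f⟩, hpf, rfl⟩
      simp only [T, Finset.coe_sigma, Set.mem_sigma_iff, Finset.mem_coe,
        Set.Finite.mem_toFinset] at hpf
      obtain ⟨hp, hf⟩ := hpf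
      split_ifs at hf with hle
      · rw [Finset.mem_piAntidiag] at hf
        refine ⟨D.add_mem hp.1 (by simpa using hZ fun i => f i), fun i => ⟨?_, fun hi => ?_⟩, ?_⟩
        · have := (hB01 p hp i).1
          simp only [Pi.add_apply]; positivity
        · have := ((hp.2 i).1 hi).1
          simp only [Pi.add_apply]; positivity
        · simp only [Pi.add_apply, Finset.sum_add_distrib, hht p hp]
          have : ht p + ∑ i, f i = n := (congrArg _ hf.1).trans (Nat.add_sub_cancel' hle)
          exact_mod_cast this
      · simp at hf
  have hinj : Set.InjOn (fun p : Σ _ : κ → ℝ, κ → ℕ => p.1 + fun i => (p.2 i : ℝ)) (T : Set _) := by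
    rintro ⟨p, f⟩ hpf ⟨p', f'⟩ hpf' heq
    have hp : p ∈ B := hB.mem_toFinset.1 (Finset.mem_sigma.1 hpf).1
    have hp' : p' ∈ B := hB.mem_toFinset.1 (Finset.mem_sigma.1 hpf').1
    have hff : f = f' := by
      ext i
      have hi := congrFun heq i
      simp only [Pi.add_apply] at hi
      have h1 : (f i : ℝ) < f' i + 1 := by
        by_cases hiA : i ∈ A
        · linarith [(hp.2 i).1 hiA, (hp'.2 i).1 hiA]
        · linarith [(hp.2 i).2 hiA, (hp'.2 i).2 hiA]
      have h2 : (f' i : ℝ) < f i + 1 := by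
        by_cases hiA : i ∈ A
        · linarith [(hp.2 i).1 hiA, (hp'.2 i).1 hiA]
        · linarith [(hp.2 i).2 hiA, (hp'.2 i).2 hiA]
      have h1' : f i < f' i + 1 := by exact_mod_cast h1
      have h2' : f' i < f i + 1 := by exact_mod_cast h2
      omega
    subst hff
    have : p = p' := add_right_cancel heq
    rw [this]
  rw [hT, hinj.ncard_image, Set.ncard_coe_finset, Finset.card_sigma,
    Polynomial.eval_finsetSum, Nat.cast_sum]
  refine Finset.sum_congr rfl fun p hp => ?_
  rw [hP]
  have hle := hhle p (hB.mem_toFinset.1 hp)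
  split_ifs with hn
  · have h1 : Fintype.card κ + (n - ht p) - 1 = (n - ht p) + (Fintype.card κ - 1) := by omega
    have h2 : n + (Fintype.card κ - 1 - ht p) = (n - ht p) + (Fintype.card κ - 1) := by omega
    rw [card_piAntidiag_nat, Finset.card_univ, h1, Nat.choose_symm_add, h2]
  · rw [Nat.choose_eq_zero_of_lt (by omega)]; simp

end HalfOpenSimplices

section Cones

variable {ι E : Type*} [NormedAddCommGroup E] [NormedSpace ℝ E] {w : ι → E} {I : Finset ι}

lemma eventually_pos_add_mul_iff {c a : ℝ} :
    (∀ᶠ ε in nhdsWithin (0 : ℝ) (Set.Ioi 0), 0 < c + ε * a) ↔ 0 ≤ c ∧ (a ≤ 0 → 0 < c) := by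
  have hlim : Filter.Tendsto (fun ε : ℝ => c + ε * a) (nhdsWithin 0 (Set.Ioi 0)) (nhds c) := by
    have : Continuous fun ε : ℝ => c + ε * a := by fun_prop
    simpa using (this.tendsto 0).mono_left nhdsWithin_le_nhds
  constructor
  · intro h
    refine ⟨ge_of_tendsto hlim (h.mono fun _ h => h.le), fun ha => ?_⟩
    obtain ⟨ε, h1, h2⟩ := (h.and self_mem_nhdsWithin).exists
    have : ε * a ≤ 0 := mul_nonpos_of_nonneg_of_nonpos (le_of_lt h2) ha
    linarith
  · rintro ⟨hc, hca⟩
    rcases lt_or_ge 0 a with ha | ha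
    · filter_upwards [self_mem_nhdsWithin] with ε (hε : 0 < ε)
      positivity
    · exact hlim.eventually_const_lt (hca ha)

lemma mem_openCone_iff_exists_subtype {x : E} :
    x ∈ openCone w I ↔ ∃ c : I → ℝ, (∀ i, 0 < c i) ∧
      Fintype.linearCombination ℝ (fun i : I => w i) c = x := by
  classical
  simp only [Fintype.linearCombination_apply]
  constructor
  · rintro ⟨c, hc, rfl⟩
    exact ⟨fun i => c i, fun i => hc i i.2, Finset.sum_coe_sort I (fun i => c i • w i)⟩
  · rintro ⟨c, hc, rfl⟩
    refine ⟨fun i => if hi : i ∈ I then c ⟨i, hi⟩ else 0, fun i hi => by simp [hi, hc], ?_⟩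
    rw [← Finset.sum_coe_sort]
    simp

lemma mem_span_of_eventually_mem_openCone {x q : E}
    (h : ∀ᶠ ε in nhdsWithin (0 : ℝ) (Set.Ioi 0), x + ε • q ∈ openCone w I) :
    q ∈ Submodule.span ℝ (w '' I) := by
  have hspan : ∀ y ∈ openCone w I, y ∈ Submodule.span ℝ (w '' I) := by
    rintro y ⟨c, -, rfl⟩
    exact Submodule.mem_span_image_finset_iff_exists_fun' (R := ℝ) |>.2 ⟨c, rfl⟩
  obtain ⟨δ, hδ, hs⟩ := mem_nhdsGT_iff_exists_Ioo_subset.1 h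
  have hδ : 0 < δ := hδ
  have h1 := hspan _ (hs ⟨half_pos hδ, half_lt_self hδ⟩)
  have h2 := hspan _ (hs (show δ / 2 / 2 ∈ Set.Ioo 0 δ from ⟨by positivity, by linarith⟩))
  have : q = (4 / δ) • ((x + (δ / 2) • q) - (x + (δ / 2 / 2) • q)) := by
    rw [add_sub_add_left_eq_sub, ← sub_smul, smul_smul]
    have : 4 / δ * (δ / 2 - δ / 2 / 2) = 1 := by field_simp; norm_num
    rw [this, one_smul]
  rw [this]
  exact Submodule.smul_mem _ _ (Submodule.sub_mem _ h1 h2)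

/-- A small push by `q = ∑ a i • w i` moves `x = ∑ c i • w i` into the open cone exactly when `x`
lies in the half-open cone whose facets with `a i ≤ 0` are removed. -/
lemma eventually_mem_openCone_iff (hI : LinearIndepOn ℝ w (I : Set ι)) (c a : I → ℝ) :
    (∀ᶠ ε in nhdsWithin (0 : ℝ) (Set.Ioi 0),
      Fintype.linearCombination ℝ (fun i : I => w i) c +
        ε • Fintype.linearCombination ℝ (fun i : I => w i) a ∈ openCone w I) ↔
      ∀ i, 0 ≤ c i ∧ (a i ≤ 0 → 0 < c i) := by
  have hinj := (linearIndependent_iff_injective_fintypeLinearCombination (R := ℝ)).1 hI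
  have hmem : ∀ c, Fintype.linearCombination ℝ (fun i : I => w i) c ∈ openCone w I ↔
      ∀ i, 0 < c i := fun c => by
    rw [mem_openCone_iff_exists_subtype]
    exact ⟨fun ⟨d, hd, hdc⟩ => hinj hdc ▸ hd, fun hc => ⟨c, hc, rfl⟩⟩
  simp only [← map_smul, ← map_add, hmem, Filter.eventually_all, Pi.add_apply, Pi.smul_apply,
    smul_eq_mul, eventually_pos_add_mul_iff]

lemma exists_linearCombination_eq_of_eventually_mem_openCone {x : E} {a : I → ℝ}
    (h : ∀ᶠ ε in nhdsWithin (0 : ℝ) (Set.Ioi 0),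
      x + ε • Fintype.linearCombination ℝ (fun i : I => w i) a ∈ openCone w I) :
    ∃ c, Fintype.linearCombination ℝ (fun i : I => w i) c = x := by
  obtain ⟨ε, hε⟩ := h.exists
  obtain ⟨c, -, hc⟩ := mem_openCone_iff_exists_subtype.1 hε
  exact ⟨c - ε • a, by rw [map_sub, map_smul, hc, add_sub_cancel_right]⟩

lemma mem_closedCone_of_eventually_mem_openCone (hI : LinearIndepOn ℝ w (I : Set ι)) {x q : E}
    (h : ∀ᶠ ε in nhdsWithin (0 : ℝ) (Set.Ioi 0), x + ε • q ∈ openCone w I) :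
    x ∈ closedCone w I := by
  classical
  obtain ⟨a, rfl⟩ := (Submodule.mem_span_image_finset_iff_exists_fun (R := ℝ)).1
    (mem_span_of_eventually_mem_openCone h)
  obtain ⟨c, rfl⟩ := exists_linearCombination_eq_of_eventually_mem_openCone h
  have hc := (eventually_mem_openCone_iff hI c a).1 h
  refine ⟨fun i => if hi : i ∈ I then c ⟨i, hi⟩ else 0, fun i hi => by simp [hi, hc], ?_⟩
  rw [← Finset.sum_coe_sort, Fintype.linearCombination_apply]
  simp

/-- Lattice points which a small push in the direction `q` moves into a simplicial open cone are
counted by a polynomial in the height. -/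
lemma exists_polynomial_pushed_openCone {h : E →ₗ[ℝ] ℝ} {Λ : AddSubgroup E}
    (hw : ∀ i, h (w i) = 1) (hwΛ : ∀ i, w i ∈ Λ) (hint : ∀ x ∈ Λ, ∃ z : ℤ, h x = z)
    (hfin : ∀ s : Set E, Bornology.IsBounded s → ((Λ : Set E) ∩ s).Finite)
    (hI : LinearIndepOn ℝ w (I : Set ι)) {q : E} (hq : 0 < h q) :
    ∃ P : Polynomial ℝ, ∀ n : ℕ, P.eval (n : ℝ) = Set.ncard {x | (x ∈ Λ ∧ h x = n) ∧
      ∀ᶠ ε in nhdsWithin (0 : ℝ) (Set.Ioi 0), x + ε • q ∈ openCone w I} := by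
  by_cases hqI : q ∈ Submodule.span ℝ (w '' I)
  swap
  · refine ⟨0, fun n => ?_⟩
    have : {x | (x ∈ Λ ∧ h x = n) ∧
        ∀ᶠ ε in nhdsWithin (0 : ℝ) (Set.Ioi 0), x + ε • q ∈ openCone w I} = ∅ :=
      Set.eq_empty_of_forall_notMem fun x hx => hqI (mem_span_of_eventually_mem_openCone hx.2)
    simp [this]
  set φ := Fintype.linearCombination ℝ (fun i : I => w i) with hφ
  have hφinj : Function.Injective φ :=
    (linearIndependent_iff_injective_fintypeLinearCombination (R := ℝ)).1 hI
  have hhφ : ∀ c, h (φ c) = ∑ i, c i := fun c => by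
    simp [hφ, Fintype.linearCombination_apply, hw]
  obtain ⟨a, rfl⟩ := (Submodule.mem_span_image_finset_iff_exists_fun (R := ℝ)).1 hqI
  replace hq : 0 < h (φ a) := hq
  change ∃ P : Polynomial ℝ, ∀ n : ℕ, P.eval (n : ℝ) = Set.ncard {x | (x ∈ Λ ∧ h x = n) ∧
      ∀ᶠ ε in nhdsWithin (0 : ℝ) (Set.Ioi 0), x + ε • φ a ∈ openCone w I}
  have hbdd : Bornology.IsBounded (φ '' Set.Icc 0 1) :=
    (isCompact_Icc.image φ.continuous_of_finiteDimensional).isBounded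
  obtain ⟨P, hP⟩ := exists_polynomial_halfOpen (Λ.comap φ.toAddMonoidHom)
    (fun f => by
      change φ _ ∈ Λ
      simp only [hφ, Fintype.linearCombination_apply]
      exact Λ.sum_mem fun i _ => by
        rw [Int.cast_smul_eq_zsmul]; exact Λ.zsmul_mem (hwΛ i) _)
    (fun c hc => by rw [← hhφ]; exact hint _ hc)
    (((hfin _ hbdd).preimage hφinj.injOn).subset fun c hc =>
      ⟨hc.1, c, ⟨fun i => (hc.2 i).1, fun i => (hc.2 i).2⟩, rfl⟩)
    {i | a i ≤ 0} (by
      by_contra! hall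
      rw [hhφ] at hq
      exact hq.not_ge (Finset.sum_nonpos fun i _ => hall i))
  refine ⟨P, fun n => ?_⟩
  rw [hP, ← Set.ncard_image_of_injective _ hφinj]
  congr 2
  ext x
  constructor
  · rintro ⟨c, ⟨hc, hc', hcn⟩, rfl⟩
    exact ⟨⟨hc, by rw [hhφ, hcn]⟩, (eventually_mem_openCone_iff hI c a).2 hc'⟩
  · rintro ⟨⟨hx, hxn⟩, hxe⟩
    obtain ⟨c, rfl⟩ := exists_linearCombination_eq_of_eventually_mem_openCone hxe
    exact ⟨c, ⟨hx, (eventually_mem_openCone_iff hI c a).1 hxe, by rw [← hhφ, hxn]⟩, rfl⟩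

/-- The lattice points of a cone generated by lattice points of height one are counted by a
polynomial in the height. -/
lemma exists_polynomial_closedCone [Fintype ι] [Nonempty ι] {h : E →ₗ[ℝ] ℝ} {Λ : AddSubgroup E}
    (hw : ∀ i, h (w i) = 1) (hwΛ : ∀ i, w i ∈ Λ) (hint : ∀ x ∈ Λ, ∃ z : ℤ, h x = z)
    (hfin : ∀ s : Set E, Bornology.IsBounded s → ((Λ : Set E) ∩ s).Finite) :
    ∃ P : Polynomial ℝ, ∀ n : ℕ, P.eval (n : ℝ) =
      Set.ncard {x | (x ∈ Λ ∧ h x = n) ∧ x ∈ closedCone w Finset.univ} := by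
  classical
  obtain ⟨G, hG, hdec⟩ := exists_openCone_decomposition hw Finset.univ
  set q := ∑ i, w i with hq
  have hqpos : 0 < h q := by simp [hq, hw, Fintype.card_pos]
  have hqcone : q ∈ closedCone w Finset.univ := ⟨fun _ => 1, by simp, by simp [hq]⟩
  have hpush : ∀ x ∈ closedCone w Finset.univ, ∃ I ∈ G,
      ∀ᶠ ε in nhdsWithin (0 : ℝ) (Set.Ioi 0), x + ε • q ∈ openCone w I := by
    intro x hx
    by_contra! hno
    have hnever : ∀ I ∈ G, ∀ᶠ ε in nhdsWithin (0 : ℝ) (Set.Ioi 0), x + ε • q ∉ openCone w I := by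
      intro I hI
      by_contra hfr
      obtain ⟨δ, hδI, hδ⟩ := (Filter.Frequently.and_eventually hfr self_mem_nhdsWithin).exists
      refine hno I hI ?_
      filter_upwards [Ioo_mem_nhdsGT hδ] with ε hε
      obtain ⟨η, hηI, hη⟩ := (Filter.Frequently.and_eventually hfr (Ioo_mem_nhdsGT hε.1)).exists
      have hpos : 0 < δ - η := by linarith [hη.2, hε.2]
      have := convex_openCone hηI hδI (a := (δ - ε) / (δ - η)) (b := (ε - η) / (δ - η))
        (div_nonneg (by linarith [hε.2]) hpos.le) (div_nonneg (by linarith [hη.2]) hpos.le)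
        (by field_simp; ring)
      refine not_not.2 ?_
      convert this using 1
      match_scalars <;> field_simp <;> ring
    obtain ⟨ε, h1, h2⟩ :=
      (((Filter.eventually_all_finset G).2 hnever).and self_mem_nhdsWithin).exists
    obtain ⟨I, ⟨hI, hxI⟩, -⟩ :=
      hdec _ (closedCone_add hx (closedCone_smul (le_of_lt h2) hqcone))
    exact h1 I hI hxI
  have huniq : ∀ x, ∀ I ∈ G, ∀ J ∈ G,
      (∀ᶠ ε in nhdsWithin (0 : ℝ) (Set.Ioi 0), x + ε • q ∈ openCone w I) →
      (∀ᶠ ε in nhdsWithin (0 : ℝ) (Set.Ioi 0), x + ε • q ∈ openCone w J) → I = J := by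
    intro x I hI J hJ h1 h2
    obtain ⟨ε, h1, h2⟩ := (h1.and h2).exists
    exact (hdec _ (openCone_subset_closedCone (hG I hI).1 h1)).unique ⟨hI, h1⟩ ⟨hJ, h2⟩
  choose! P hP using fun (I : Finset ι) (hI : I ∈ G) =>
    exists_polynomial_pushed_openCone hw hwΛ hint hfin (hG I hI).2 hqpos
  refine ⟨∑ I ∈ G, P I, fun n => ?_⟩
  have hXfin : {x | (x ∈ Λ ∧ h x = n) ∧ x ∈ closedCone w Finset.univ}.Finite := by
    have hbdd : Bornology.IsBounded
        (Fintype.linearCombination ℝ w '' Set.Icc 0 (fun _ => (n : ℝ))) :=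
      (isCompact_Icc.image (LinearMap.continuous_of_finiteDimensional _)).isBounded
    refine (hfin _ hbdd).subset ?_
    rintro _ ⟨⟨hx, hxn⟩, c, hc, rfl⟩
    refine ⟨hx, c, ⟨fun i => hc i (Finset.mem_univ i), fun i => ?_⟩, rfl⟩
    simp only [map_sum, map_smul, hw, smul_eq_mul, mul_one] at hxn
    rw [← hxn]
    exact Finset.single_le_sum hc (Finset.mem_univ i)
  choose! f hfG hf using hpush
  rw [Set.ncard_eq_toFinset_card _ hXfin, Finset.card_eq_sum_card_fiberwise (f := f) (t := G)
    (fun x hx => hfG x (hXfin.mem_toFinset.1 hx).2), Polynomial.eval_finsetSum, Nat.cast_sum]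
  refine Finset.sum_congr rfl fun I hI => ?_
  rw [hP I hI, ← Set.ncard_coe_finset]
  congr 2
  ext x
  simp only [Finset.coe_filter, Set.Finite.mem_toFinset, Set.mem_ofPred_eq]
  constructor
  · rintro ⟨hx, hxI⟩
    have hxc := closedCone_mono (hG I hI).1
      (mem_closedCone_of_eventually_mem_openCone (hG I hI).2 hxI)
    exact ⟨⟨hx, hxc⟩, huniq x _ (hfG x hxc) I hI (hf x hxc) hxI⟩
  · rintro ⟨⟨hx, hxc⟩, rfl⟩
    exact ⟨hx, hf x hxc⟩

end Cones

open Filter Topology in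
lemma Polynomial.degree_eq_and_coeff_eq_of_tendsto {P : Polynomial ℝ} {m : ℕ} {v : ℝ} (hv : v ≠ 0)
    (h : Tendsto (fun n : ℕ => P.eval (n : ℝ) / (n : ℝ) ^ m) atTop (𝓝 v)) :
    P.degree = m ∧ P.coeff m = v := by
  have hX : ∀ x : ℝ, x ^ m = (X ^ m : Polynomial ℝ).eval x := by simp
  simp only [hX] at h
  have hdX : (X ^ m : Polynomial ℝ).degree = m := degree_X_pow m
  have hnat := tendsto_natCast_atTop_atTop (R := ℝ)
  rcases lt_trichotomy P.degree (X ^ m : Polynomial ℝ).degree with hlt | heq | hgt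
  · exact absurd (tendsto_nhds_unique h
      ((div_tendsto_atTop_zero_of_degree_lt P _ hlt).comp hnat)) hv
  · have := tendsto_nhds_unique h
      ((div_tendsto_atTop_leadingCoeff_div_of_degree_eq P _ heq).comp hnat)
    rw [hdX] at heq
    refine ⟨heq, ?_⟩
    rw [this, leadingCoeff, natDegree_eq_of_degree_eq_some heq]
    simp
  · exact absurd h.abs (not_tendsto_nhds_of_tendsto_atTop
      ((abs_div_tendsto_atTop_atTop_of_degree_gt P _ hgt (monic_X_pow m).ne_zero).comp hnat) _)

/-- Homogenization: the slice of height `t` of the cone over a polytope is its `t`-th dilation. -/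
lemma mem_closedCone_prod_one_iff {ι F : Type*} [Fintype ι] [Nonempty ι] [AddCommGroup F]
    [Module ℝ F] (v : ι → F) (y : F) {t : ℝ} (ht : 0 ≤ t) :
    (y, t) ∈ closedCone (fun i => (v i, (1 : ℝ))) Finset.univ ↔
      y ∈ t • convexHull ℝ (Set.range v) := by
  classical
  constructor
  · rintro ⟨c, hc, hcy⟩
    obtain ⟨rfl, rfl⟩ : ∑ i, c i • v i = y ∧ ∑ i, c i = t := by
      simpa [Prod.ext_iff, Prod.fst_sum, Prod.snd_sum] using hcy
    rcases ht.eq_or_lt with h0 | hpos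
    · have hc0 : ∀ i, c i = 0 := fun i =>
        (Finset.sum_eq_zero_iff_of_nonneg hc).1 h0.symm i (Finset.mem_univ i)
      rw [← h0, Set.zero_smul_set (Set.range_nonempty v).convexHull]
      simp [hc0]
    · refine ⟨∑ i, (c i / ∑ j, c j) • v i, mem_convexHull_of_exists_fintype _ v
        (fun i => div_nonneg (hc i (Finset.mem_univ i)) ht)
        (by rw [← Finset.sum_div, div_self hpos.ne']) (fun i => ⟨i, rfl⟩) rfl, ?_⟩
      simp only [Finset.smul_sum, smul_smul, mul_div_cancel₀ _ hpos.ne']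
  · rintro ⟨z, hz, rfl⟩
    have hsub : convexHull ℝ (Set.range v) ⊆
        {z | (z, (1 : ℝ)) ∈ closedCone (fun i => (v i, (1 : ℝ))) Finset.univ} := by
      refine convexHull_min ?_ ?_
      · rintro _ ⟨i, rfl⟩
        exact ⟨Pi.single i 1, fun j _ => by by_cases h : j = i <;> simp [h],
          by simp [Pi.single_apply]⟩
      · intro z hz z' hz' a b ha hb hab
        have := closedCone_add (closedCone_smul ha hz) (closedCone_smul hb hz')
        simpa [hab] using this
    simpa using closedCone_smul ht (hsub hz)

/-- The lattice `ℤ^m × ℤ` inside `ℝ^m × ℝ`. -/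
def integerLattice (m : ℕ) : AddSubgroup ((Fin m → ℝ) × ℝ) :=
  (((Int.castAddHom ℝ).compLeft (Fin m)).prodMap (Int.castAddHom ℝ)).range

lemma mem_integerLattice {m : ℕ} {x : (Fin m → ℝ) × ℝ} :
    x ∈ integerLattice m ↔ ∃ (v : Fin m → ℤ) (k : ℤ), ((fun j => (v j : ℝ)), (k : ℝ)) = x :=
  ⟨fun ⟨⟨v, k⟩, h⟩ => ⟨v, k, h⟩, fun ⟨v, k, h⟩ => ⟨⟨v, k⟩, h⟩⟩

lemma finite_integerLattice_inter {m : ℕ} {s : Set ((Fin m → ℝ) × ℝ)}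
    (hs : Bornology.IsBounded s) : ((integerLattice m : Set _) ∩ s).Finite := by
  obtain ⟨R, hR⟩ := hs.exists_norm_le
  refine (((Set.finite_Icc (fun _ : Fin m => -⌈R⌉) (fun _ => ⌈R⌉)).prod
    (Set.finite_Icc (-⌈R⌉) ⌈R⌉)).image
    fun p : (Fin m → ℤ) × ℤ => ((fun j => (p.1 j : ℝ)), (p.2 : ℝ))).subset ?_
  rintro x ⟨hx, hxs⟩
  obtain ⟨v, k, rfl⟩ := mem_integerLattice.1 hx
  have key : ∀ z : ℤ, ‖(z : ℝ)‖ ≤ R → -⌈R⌉ ≤ z ∧ z ≤ ⌈R⌉ := fun z hz => by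
    have h := abs_le.1 ((Real.norm_eq_abs _).symm.le.trans (hz.trans (Int.le_ceil R)))
    exact ⟨by exact_mod_cast h.1, by exact_mod_cast h.2⟩
  have hv := fun j => key (v j) (((norm_le_pi_norm (fun j => (v j : ℝ)) j).trans
    (norm_fst_le ((fun j => (v j : ℝ)), (k : ℝ)))).trans (hR _ hxs))
  have hk := key k ((norm_snd_le _).trans (hR _ hxs))
  exact ⟨(v, k), ⟨⟨fun j => (hv j).1, fun j => (hv j).2⟩, hk⟩, rfl⟩

lemma intCast_comp_injective (m : ℕ) :
    Function.Injective (fun (v : Fin m → ℤ) => fun j => (v j : ℝ)) := fun _ _ h =>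
  funext fun j => Int.cast_injective (congrFun h j)

open Filter Topology in
lemma tendsto_ncard_smul_div_pow {m : ℕ} {Δ : Set (Fin m → ℝ)} (hb : Bornology.IsBounded Δ)
    (hmeas : MeasurableSet Δ) (hfr : volume (frontier Δ) = 0) :
    Tendsto (fun n : ℕ => (Set.ncard {v : Fin m → ℤ | (fun j => (v j : ℝ)) ∈ (n : ℝ) • Δ} : ℝ) /
      (n : ℝ) ^ m) atTop (𝓝 (volume Δ).toReal) := by
  have h := tendsto_card_div_pow_atTop_volume Δ hb hmeas hfr
  rw [Fintype.card_fin] at h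
  refine h.congr' ?_
  filter_upwards [eventually_gt_atTop 0] with n hn
  have hn0 : (n : ℝ) ≠ 0 := by positivity
  congr 2
  rw [Nat.card_coe_set_eq, ← Set.ncard_image_of_injective _
    ((smul_right_injective (Fin m → ℝ) (inv_ne_zero hn0)).comp (intCast_comp_injective m))]
  congr 1
  ext x
  simp only [Set.mem_inter_iff, Set.mem_image, Function.comp, Set.mem_ofPred_eq]
  constructor
  · rintro ⟨hx, y, hy, rfl⟩
    have := (Module.Basis.mem_span_iff_repr_mem ℤ (Pi.basisFun ℝ (Fin m)) y).1 hy
    simp only [Pi.basisFun_repr, Set.mem_range, algebraMap_int_eq, eq_intCast] at this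
    choose v hv using this
    obtain rfl : (fun j => (v j : ℝ)) = y := funext hv
    exact ⟨v, (Set.mem_smul_set_iff_inv_smul_mem₀ hn0 _ _).2 hx, rfl⟩
  · rintro ⟨v, hv, rfl⟩
    refine ⟨(Set.mem_smul_set_iff_inv_smul_mem₀ hn0 _ _).1 hv, _, ?_, rfl⟩
    exact (Module.Basis.mem_span_iff_repr_mem ℤ (Pi.basisFun ℝ (Fin m)) _).2 fun j => ⟨v j, by simp⟩

/-- Lattice points in the dilations of an integral polytope are counted by a polynomial. -/
lemma exists_polynomial_ncard_smul_convexHull {m : ℕ} {ι : Type*} [Fintype ι] [Nonempty ι]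
    (s : ι → Fin m → ℤ) :
    ∃ P : Polynomial ℝ, ∀ n : ℕ, P.eval (n : ℝ) = Set.ncard {v : Fin m → ℤ |
      (fun j => (v j : ℝ)) ∈ (n : ℝ) • convexHull ℝ (Set.range fun i j => (s i j : ℝ))} := by
  obtain ⟨P, hP⟩ := exists_polynomial_closedCone (h := LinearMap.snd ℝ (Fin m → ℝ) ℝ)
    (Λ := integerLattice m) (w := fun i => ((fun j => (s i j : ℝ)), (1 : ℝ))) (fun _ => rfl)
    (fun i => mem_integerLattice.2 ⟨s i, 1, by simp⟩)
    (fun x hx => by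
      obtain ⟨v, k, rfl⟩ := mem_integerLattice.1 hx
      exact ⟨k, rfl⟩)
    (fun _ => finite_integerLattice_inter)
  refine ⟨P, fun n => ?_⟩
  have hinj : Function.Injective
      (fun v : Fin m → ℤ => ((fun j => (v j : ℝ)), (n : ℝ))) := fun _ _ h =>
    intCast_comp_injective m (congrArg Prod.fst h)
  rw [hP, ← Set.ncard_image_of_injective _ hinj]
  congr 2
  ext x
  constructor
  · rintro ⟨⟨hx, hxn⟩, hxc⟩
    obtain ⟨v, k, rfl⟩ := mem_integerLattice.1 hx
    have hk : (k : ℝ) = n := hxn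
    rw [hk] at hxc ⊢
    exact ⟨v, (mem_closedCone_prod_one_iff _ _ n.cast_nonneg).1 hxc, rfl⟩
  · rintro ⟨v, hv, rfl⟩
    exact ⟨⟨mem_integerLattice.2 ⟨v, n, by simp⟩, rfl⟩,
      (mem_closedCone_prod_one_iff _ _ n.cast_nonneg).2 hv⟩

/-- Ehrhart: For an integral polytope Δ ⊂ ℝ^m with nonempty interior
there is a polynomial E of degree m, leading coefficient Vol(Δ), E(0) = 1, with
E(i) = #(iΔ ∩ ℤ^m) for every natural number i. -/
theorem ehrhart_polynomial (m : ℕ) (hm : 1 ≤ m) (S : Finset (Fin m → ℤ))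
    (Δ : Set (Fin m → ℝ))
    (hΔ : Δ = convexHull ℝ ((fun v : Fin m → ℤ => fun i => (v i : ℝ)) '' (S : Set (Fin m → ℤ))))
    (hint : (interior Δ).Nonempty) :
    ∃ E : Polynomial ℝ,
      E.degree = (m : ℕ) ∧
      E.coeff m = (volume Δ).toReal ∧
      E.eval 0 = 1 ∧
      ∀ i : ℕ, E.eval (i : ℝ) =
        Set.ncard {v : Fin m → ℤ | (fun j => (v j : ℝ)) ∈ (i : ℝ) • Δ} := by
  have hne : Δ.Nonempty := hint.mono interior_subset
  have hS : Nonempty S := by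
    rw [hΔ, convexHull_nonempty_iff, Set.image_nonempty] at hne
    exact hne.to_subtype
  have hrange : Δ = convexHull ℝ (Set.range fun (s : S) j => (s.1 j : ℝ)) := by
    rw [hΔ, Set.image_eq_range]; rfl
  obtain ⟨P, hP⟩ := exists_polynomial_ncard_smul_convexHull fun s : S => s.1
  rw [← hrange] at hP
  have hconv : Convex ℝ Δ := hΔ ▸ convex_convexHull ℝ _
  have hcomp : IsCompact Δ := hΔ ▸ (S.finite_toSet.image _).isCompact_convexHull ℝ
  have hvol : (volume Δ).toReal ≠ 0 :=
    (ENNReal.toReal_pos (Measure.measure_pos_of_nonempty_interior _ hint).ne'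
      hcomp.measure_lt_top.ne).ne'
  have hlim := tendsto_ncard_smul_div_pow hcomp.isBounded hcomp.measurableSet
    (hconv.addHaar_frontier volume)
  simp only [← hP] at hlim
  obtain ⟨hdeg, hcoeff⟩ := Polynomial.degree_eq_and_coeff_eq_of_tendsto hvol hlim
  refine ⟨P, hdeg, hcoeff, ?_, hP⟩
  have h0 : {v : Fin m → ℤ | (fun j => (v j : ℝ)) ∈ ((0 : ℕ) : ℝ) • Δ} = {0} := by
    ext v
    simp [Set.zero_smul_set hne, funext_iff]
  have := hP 0
  rw [h0, Set.ncard_singleton] at this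
  simpa using this
end

section
/- Let m ≥ 1 and let Δ ⊂ ℝ^m be an integral polytope, i.e. the convex hull of a finite subset of ℤ^m, and assume Δ has nonempty interior. Then in the ring of formal power series ℤ[[t]], the product (1 − t)^{m+1} · ∑_{k=0}^∞ #(kΔ ∩ ℤ^m) t^k is a polynomial in t of degree at most m; in particular the lattice-point generating series of Δ is a rational function of t with denominator (1 − t)^{m+1}. -/
open Pointwise PowerSeries

namespace Ehrhart

/-! ### Lexicographic positivity along a list of coordinates -/

/-- The first nonzero coordinate of `r` along the list `l` exists and is positive. -/
def LexPos {ι : Type*} : List ι → (ι → ℝ) → Prop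
  | [], _ => False
  | i :: l, r => 0 < r i ∨ (r i = 0 ∧ LexPos l r)

theorem LexPos.smul {ι : Type*} {l : List ι} {r : ι → ℝ} {c : ℝ} (hc : 0 < c)
    (h : LexPos l r) : LexPos l (c • r) := by
  induction l with
  | nil => exact h
  | cons i l ih =>
    rcases h with h | ⟨h, h'⟩
    · exact Or.inl (mul_pos hc h)
    · exact Or.inr ⟨by simp [h], ih h'⟩

theorem lexPos_trichotomy {ι : Type*} (l : List ι) (r : ι → ℝ) :
    (∀ i ∈ l, r i = 0) ∨ LexPos l r ∨ LexPos l (-r) := by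
  induction l with
  | nil => simp
  | cons i l ih =>
    rcases lt_trichotomy (r i) 0 with h | h | h
    · exact Or.inr (Or.inr (Or.inl (by simpa using h)))
    · rcases ih with ih | ih | ih
      · exact Or.inl (by simpa [h] using ih)
      · exact Or.inr (Or.inl (Or.inr ⟨h, ih⟩))
      · exact Or.inr (Or.inr (Or.inr ⟨by simp [h], ih⟩))
    · exact Or.inr (Or.inl (Or.inl h))

theorem exists_lexMax {ι : Type*} (l : List ι) {K : Set (ι → ℝ)} (hK : IsCompact K)
    (hne : K.Nonempty) : ∃ x ∈ K, ∀ y ∈ K, ¬ LexPos l (y - x) := by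
  induction l generalizing K with
  | nil => exact hne.imp fun x hx => ⟨hx, fun _ _ h => h⟩
  | cons i l ih =>
    obtain ⟨z, hz, hmax⟩ := hK.exists_isMaxOn hne (continuous_apply i).continuousOn
    obtain ⟨x, ⟨hxK, hxi⟩, hx⟩ := ih (K := K ∩ {y | y i = z i})
      (hK.inter_right (isClosed_eq (continuous_apply i) continuous_const)) ⟨z, hz, rfl⟩
    have hxi : x i = z i := hxi
    refine ⟨x, hxK, fun y hy h => ?_⟩
    have hyz : y i ≤ z i := hmax hy
    rcases h with h | ⟨h, h'⟩
    · simp only [Pi.sub_apply] at h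
      linarith
    · simp only [Pi.sub_apply] at h
      exact hx y ⟨hy, show y i = z i by linarith⟩ h'

/-- The condition on the `i`-th coefficient of a point of the half-open simplicial cone on the
vertices in `τ`, in which all coefficients are positive except that of `o`, which may vanish. -/
def HalfOpen {ι : Type*} (τ : Finset ι) (o i : ι) (a : ℝ) : Prop :=
  (i ∉ τ → a = 0) ∧ (i = o → 0 ≤ a) ∧ (i ≠ o → i ∈ τ → 0 < a)

theorem HalfOpen.nonneg {ι : Type*} {τ : Finset ι} {o i : ι} {a : ℝ} (h : HalfOpen τ o i a) :
    0 ≤ a := by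
  by_cases ho : i = o
  · exact h.2.1 ho
  · by_cases hi : i ∈ τ
    · exact (h.2.2 ho hi).le
    · exact (h.1 hi).ge

theorem HalfOpen.add_one {ι : Type*} {τ : Finset ι} {o i : ι} {a : ℝ} (hi : i ∈ τ)
    (h : HalfOpen τ o i a) :
    HalfOpen τ o i (a + 1) := by
  have := h.nonneg
  exact ⟨fun h' => absurd hi h', fun _ => by linarith, fun _ _ => by linarith⟩

section Cone

variable {ι : Type*} [Fintype ι] {m : ℕ}

/-- The map sending coefficients `r` to `∑ i, r i • (w i, 1)`. -/
noncomputable def coneMap (w : ι → Fin m → ℤ) : (ι → ℝ) →ₗ[ℝ] (Fin m → ℝ) × ℝ :=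
  Fintype.linearCombination ℝ fun i => ((fun j => (w i j : ℝ)), (1 : ℝ))

theorem coneMap_eq_iff (w : ι → Fin m → ℤ) (r : ι → ℝ) (x : Fin m → ℝ) (k : ℝ) :
    coneMap w r = (x, k) ↔ (∀ j, ∑ i, r i * w i j = x j) ∧ ∑ i, r i = k := by
  simp [coneMap, Fintype.linearCombination_apply, Prod.ext_iff, Prod.fst_sum, Prod.snd_sum,
    funext_iff]

theorem coneMap_single [DecidableEq ι] (w : ι → Fin m → ℤ) (i : ι) :
    coneMap w (Pi.single i 1) = ((fun j => (w i j : ℝ)), (1 : ℝ)) := by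
  simp [coneMap]

/-- The lattice points at height `k` which are combinations of the points `(w i, 1)` with
coefficients satisfying `P`. -/
def level (w : ι → Fin m → ℤ) (P : ι → ℝ → Prop) (k : ℕ) : Set (Fin m → ℤ) :=
  {v | ∃ r : ι → ℝ, (∀ i, P i (r i)) ∧ coneMap w r = ((fun j => (v j : ℝ)), (k : ℝ))}

theorem level_finite (w : ι → Fin m → ℤ) {P : ι → ℝ → Prop} (hP : ∀ i a, P i a → 0 ≤ a)
    (k : ℕ) : (level w P k).Finite := by
  let B : Fin m → ℤ := fun j => ∑ i, k * |w i j|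
  refine (Set.finite_Icc (-B) B).subset ?_
  rintro v ⟨r, hr, h⟩
  rw [coneMap_eq_iff] at h
  have hb : ∀ j, |v j| ≤ B j := by
    intro j
    have h0 : ∀ i, 0 ≤ r i := fun i => hP i _ (hr i)
    have hk : ∀ i, r i ≤ k := fun i => by
      rw [← h.2]
      exact Finset.single_le_sum (fun i _ => h0 i) (Finset.mem_univ i)
    have : |(v j : ℝ)| ≤ ∑ i, (k : ℝ) * |(w i j : ℝ)| := by
      rw [← h.1 j]
      refine (Finset.abs_sum_le_sum_abs _ _).trans (Finset.sum_le_sum fun i _ => ?_)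
      rw [abs_mul, abs_of_nonneg (h0 i)]
      exact mul_le_mul_of_nonneg_right (hk i) (abs_nonneg _)
    exact_mod_cast this
  exact ⟨fun j => (abs_le.mp (hb j)).1, fun j => (abs_le.mp (hb j)).2⟩

/-- The generating series of the number of lattice points at each height. -/
noncomputable def levelSeries (w : ι → Fin m → ℤ) (P : ι → ℝ → Prop) : PowerSeries ℤ :=
  PowerSeries.mk fun k => ((level w P k).ncard : ℤ)

theorem one_sub_X_mul_levelSeries (w : ι → Fin m → ℤ) {P Q : ι → ℝ → Prop} (j : ι)
    (hP : ∀ i a, P i a → 0 ≤ a) (hup : ∀ a, P j a → P j (a + 1))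
    (hQ : ∀ i ≠ j, Q i = P i) (hQj : ∀ a, Q j a ↔ P j a ∧ ¬ P j (a - 1))
    (hinj : ∀ r s : ι → ℝ, (∀ i, P i (r i)) → (∀ i, P i (s i)) →
      coneMap w r = coneMap w s → r = s) :
    (1 - X) * levelSeries w P = levelSeries w Q := by
  classical
  have hQP : ∀ i a, Q i a → P i a := by
    intro i a h
    by_cases hij : i = j
    · subst hij
      exact ((hQj a).1 h).1
    · rwa [← hQ i hij]
  have hQ_of : ∀ r : ι → ℝ, (∀ i, P i (r i)) → ¬ P j (r j - 1) → ∀ i, Q i (r i) := by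
    intro r hr hj i
    by_cases hij : i = j
    · subst hij
      exact (hQj _).2 ⟨hr i, hj⟩
    · rw [hQ i hij]
      exact hr i
  have hP_sub : ∀ r : ι → ℝ, (∀ i, P i (r i)) → P j (r j - 1) →
      ∀ i, P i ((r - Pi.single j 1 : ι → ℝ) i) := by
    intro r hr hj i
    by_cases hij : i = j
    · subst hij
      simpa using hj
    · simpa [hij] using hr i
  have hP_add : ∀ r : ι → ℝ, (∀ i, P i (r i)) →
      ∀ i, P i ((r + Pi.single j 1 : ι → ℝ) i) := by
    intro r hr i
    by_cases hij : i = j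
    · subst hij
      simpa using hup _ (hr i)
    · simpa [hij] using hr i
  ext k
  rw [sub_mul, one_mul, map_sub]
  cases k with
  | zero =>
    simp only [coeff_zero_X_mul, sub_zero, levelSeries, coeff_mk]
    congr 2
    ext v
    refine ⟨?_, fun ⟨r, hr, h⟩ => ⟨r, fun i => hQP i _ (hr i), h⟩⟩
    rintro ⟨r, hr, h⟩
    refine ⟨r, hQ_of r hr fun hj => ?_, h⟩
    have h1 := hP _ _ hj
    have h2 := ((coneMap_eq_iff _ _ _ _).1 h).2
    have h3 := Finset.single_le_sum (fun i _ => hP i _ (hr i)) (Finset.mem_univ j)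
    rw [h2] at h3
    norm_num at h3
    linarith
  | succ k =>
    simp only [coeff_succ_X_mul, levelSeries, coeff_mk]
    have hunion : level w P (k + 1) = level w Q (k + 1) ∪ (· + w j) '' level w P k := by
      ext v
      constructor
      · rintro ⟨r, hr, h⟩
        by_cases hj : P j (r j - 1)
        · refine Or.inr ⟨v - w j, ⟨r - Pi.single j 1, hP_sub r hr hj, ?_⟩, by simp⟩
          rw [map_sub, h, coneMap_single]
          ext <;> simp
        · exact Or.inl ⟨r, hQ_of r hr hj, h⟩
      · rintro (⟨r, hr, h⟩ | ⟨v, ⟨r, hr, h⟩, rfl⟩)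
        · exact ⟨r, fun i => hQP i _ (hr i), h⟩
        · refine ⟨r + Pi.single j 1, hP_add r hr, ?_⟩
          rw [map_add, h, coneMap_single]
          ext <;> simp
    have hdisj : Disjoint (level w Q (k + 1)) ((· + w j) '' level w P k) := by
      rw [Set.disjoint_left]
      rintro _ ⟨r, hr, h⟩ ⟨v, ⟨s, hs, h'⟩, rfl⟩
      have heq : r = s + Pi.single j 1 := by
        refine hinj _ _ (fun i => hQP i _ (hr i)) (hP_add s hs) ?_
        rw [map_add, h, h', coneMap_single]
        ext <;> simp
      refine ((hQj _).1 (hr j)).2 ?_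
      simpa [heq] using hs j
    rw [hunion, Set.ncard_union_eq hdisj (level_finite w (fun i a h => hP i a (hQP i a h)) _)
      ((level_finite w hP k).image _), Set.ncard_image_of_injective _ (add_left_injective _)]
    push_cast
    ring

theorem exists_polynomial_halfOpen (w : ι → Fin m → ℤ) {τ : Finset ι} {o : ι} (ho : o ∈ τ)
    (hind : ∀ r : ι → ℝ, (∀ i ∉ τ, r i = 0) → coneMap w r = 0 → r = 0) :
    ∃ p : Polynomial ℤ, p.degree < τ.card ∧
      (p : PowerSeries ℤ) = (1 - X) ^ τ.card * levelSeries w (HalfOpen τ o) := by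
  classical
  let P : Finset ι → ι → ℝ → Prop := fun A i a =>
    HalfOpen τ o i a ∧ (i ∈ A → ¬ HalfOpen τ o i (a - 1))
  have hstep : ∀ A ⊆ τ, levelSeries w (P A) = (1 - X) ^ A.card * levelSeries w (HalfOpen τ o) := by
    intro A
    induction A using Finset.induction_on with
    | empty =>
      intro _
      simp [P]
    | insert j A hj ih =>
      intro hA
      have hjτ : j ∈ τ := hA (Finset.mem_insert_self j A)
      rw [Finset.card_insert_of_notMem hj, pow_succ', mul_assoc,
        ← ih fun i hi => hA (Finset.mem_insert_of_mem hi)]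
      symm
      refine one_sub_X_mul_levelSeries w j (fun i a h => h.1.nonneg)
        (fun a h => ⟨h.1.add_one hjτ, fun h' => absurd h' hj⟩) ?_ ?_ ?_
      · intro i hij
        simp [P, Finset.mem_insert, hij]
      · intro a
        simp [P, hj]
      · intro r s hr hs h
        refine sub_eq_zero.1 (hind (r - s) (fun i hi => ?_) (by rw [map_sub, h, sub_self]))
        simp [(hr i).1.1 hi, (hs i).1.1 hi]
  have hvanish : ∀ k, τ.card ≤ k → level w (P τ) k = ∅ := by
    intro k hk
    rw [Set.eq_empty_iff_forall_notMem]
    rintro v ⟨r, hr, h⟩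
    have hsum := ((coneMap_eq_iff _ _ _ _).1 h).2
    have hlt : ∑ i, r i < τ.card := by
      rw [← Finset.sum_subset (Finset.subset_univ τ) fun i _ hi => (hr i).1.1 hi,
        Finset.card_eq_sum_ones, Nat.cast_sum]
      refine Finset.sum_lt_sum (fun i hi => ?_) ⟨o, ho, ?_⟩
      · by_contra! hlt
        refine (hr i).2 hi ⟨fun h' => absurd hi h', fun _ => ?_, fun _ _ => ?_⟩ <;>
          push_cast at hlt <;> linarith
      · by_contra! hlt
        refine (hr o).2 ho ⟨fun h' => absurd ho h', fun _ => ?_, fun h' => absurd rfl h'⟩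
        push_cast at hlt
        linarith
    rw [hsum] at hlt
    exact absurd (Nat.cast_lt.1 hlt) (not_lt.2 hk)
  refine ⟨trunc τ.card (levelSeries w (P τ)), degree_trunc_lt _ _, ?_⟩
  rw [← hstep τ subset_rfl]
  ext k
  rw [Polynomial.coeff_coe, coeff_trunc]
  split_ifs with hk
  · rfl
  · simp [levelSeries, hvanish k (not_lt.1 hk)]

theorem card_le_of_coneMap_injective (w : ι → Fin m → ℤ) {τ : Finset ι}
    (hind : ∀ r : ι → ℝ, (∀ i ∉ τ, r i = 0) → coneMap w r = 0 → r = 0) : τ.card ≤ m + 1 := by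
  classical
  have hli : LinearIndependent ℝ fun i : τ => (((fun j => (w i j : ℝ)), 1) : (Fin m → ℝ) × ℝ) := by
    rw [Fintype.linearIndependent_iff]
    intro g hg i
    let r : ι → ℝ := fun i => if hi : i ∈ τ then g ⟨i, hi⟩ else 0
    have hr : r = 0 := by
      refine hind r (fun i hi => by simp [r, hi]) ?_
      rw [coneMap, Fintype.linearCombination_apply,
        ← Finset.sum_subset (Finset.subset_univ τ) fun i _ hi => by simp [r, hi],
        ← Finset.sum_coe_sort, ← hg]
      exact Finset.sum_congr rfl fun i _ => by simp [r]
    simpa [r] using congrFun hr i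
  simpa using hli.fintype_card_le_finrank

/-- The faces of the triangulation of the cone on the points `(w i, 1)` which is obtained by
choosing lexicographically maximal coefficients along `l`. -/
def IsFace (w : ι → Fin m → ℤ) (l : List ι) (τ : Finset ι) : Prop :=
  ∀ r : ι → ℝ, coneMap w r = 0 → (∀ i ∉ τ, 0 ≤ r i) → ¬ LexPos l r

theorem IsFace.eq_zero {w : ι → Fin m → ℤ} {l : List ι} (hl : ∀ i, i ∈ l) {τ τ' : Finset ι}
    (h : IsFace w l τ) (h' : IsFace w l τ') {r : ι → ℝ} (hr : coneMap w r = 0)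
    (h0 : ∀ i ∉ τ, 0 ≤ r i) (h0' : ∀ i ∉ τ', r i ≤ 0) : r = 0 := by
  rcases lexPos_trichotomy l r with h1 | h1 | h1
  · exact funext fun i => h1 i (hl i)
  · exact absurd h1 (h r hr h0)
  · exact absurd h1 (h' (-r) (by rw [map_neg, hr, neg_zero]) fun i hi => by simpa using h0' i hi)

theorem isCompact_fiber (w : ι → Fin m → ℤ) (x : (Fin m → ℝ) × ℝ) :
    IsCompact {r : ι → ℝ | (∀ i, 0 ≤ r i) ∧ coneMap w r = x} := by
  refine (isCompact_Icc (a := (0 : ι → ℝ)) (b := fun _ => x.2)).of_isClosed_subset ?_ ?_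
  · refine IsClosed.inter ?_ ?_
    · exact isClosed_le (continuous_const (y := (0 : ι → ℝ))) continuous_id
    · exact isClosed_eq (coneMap w).continuous_of_finiteDimensional continuous_const
  · rintro r ⟨h0, h⟩
    refine ⟨h0, fun i => ?_⟩
    have := ((coneMap_eq_iff w r x.1 x.2).1 h).2
    rw [← this]
    exact Finset.single_le_sum (fun i _ => h0 i) (Finset.mem_univ i)

/-- Every point of the cone lies in the half-open cone on some face. -/
theorem exists_isFace (w : ι → Fin m → ℤ) (o : ι) (l : List ι) {x : (Fin m → ℝ) × ℝ}
    {s : ι → ℝ} (hs : ∀ i, 0 ≤ s i) (hsx : coneMap w s = x) :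
    ∃ τ : Finset ι, (o ∈ τ ∧ IsFace w (o :: l) τ) ∧
      ∃ r : ι → ℝ, (∀ i, HalfOpen τ o i (r i)) ∧ coneMap w r = x := by
  classical
  obtain ⟨r, ⟨hr0, hrx⟩, hmax⟩ := exists_lexMax (o :: l) (isCompact_fiber w x) ⟨s, hs, hsx⟩
  refine ⟨Finset.univ.filter fun i => i = o ∨ 0 < r i, ⟨by simp, ?_⟩, r, fun i => ?_, hrx⟩
  · intro d hd hd0 hpos
    have hdo : 0 ≤ d o := by
      rcases hpos with h | ⟨h, _⟩
      · exact h.le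
      · exact h.ge
    have hev : ∀ i, ∀ᶠ ε in nhdsWithin (0 : ℝ) (Set.Ioi 0), 0 ≤ r i + ε * d i := by
      intro i
      by_cases hi : i ≠ o ∧ 0 < r i
      · have hc : Filter.Tendsto (fun ε : ℝ => r i + ε * d i) (nhdsWithin 0 (Set.Ioi 0))
            (nhds (r i + 0 * d i)) :=
          (Continuous.tendsto (by fun_prop) 0).mono_left nhdsWithin_le_nhds
        rw [zero_mul, add_zero] at hc
        exact (hc.eventually (lt_mem_nhds hi.2)).mono fun _ h => h.le
      · have hdi : 0 ≤ d i := by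
          by_cases hio : i = o
          · rwa [hio]
          · refine hd0 i ?_
            simp only [Finset.mem_filter, Finset.mem_univ, true_and]
            tauto
        filter_upwards [self_mem_nhdsWithin] with ε hε
        exact add_nonneg (hr0 i) (mul_nonneg (le_of_lt hε) hdi)
    obtain ⟨ε, hε, hε0⟩ :=
      ((Filter.eventually_all.2 hev).and self_mem_nhdsWithin).exists
    refine hmax (r + ε • d) ⟨fun i => by simpa using hε i, ?_⟩ ?_
    · rw [map_add, map_smul, hd, smul_zero, add_zero, hrx]
    · rw [add_sub_cancel_left]
      exact hpos.smul hε0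
  · refine ⟨fun hi => ?_, fun _ => hr0 i, fun hio hi => ?_⟩
    · simp only [Finset.mem_filter, Finset.mem_univ, true_and, not_or] at hi
      exact le_antisymm (not_lt.1 hi.2) (hr0 i)
    · simp only [Finset.mem_filter, Finset.mem_univ, true_and] at hi
      exact hi.resolve_left hio

/-- Half-open cones on distinct faces are disjoint. -/
theorem IsFace.unique {w : ι → Fin m → ℤ} {l : List ι} (hl : ∀ i, i ∈ l) {o : ι}
    {τ τ' : Finset ι} (ho : o ∈ τ) (ho' : o ∈ τ') (h : IsFace w l τ) (h' : IsFace w l τ')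
    {r s : ι → ℝ} (hr : ∀ i, HalfOpen τ o i (r i)) (hs : ∀ i, HalfOpen τ' o i (s i))
    (hrs : coneMap w r = coneMap w s) : τ = τ' := by
  have heq : s - r = 0 := by
    refine h.eq_zero hl h' (by rw [map_sub, hrs, sub_self]) (fun i hi => ?_) fun i hi => ?_
    · simpa [(hr i).1 hi] using (hs i).nonneg
    · simpa [(hs i).1 hi] using (hr i).nonneg
  have heq : s = r := sub_eq_zero.1 heq
  subst heq
  ext i
  by_cases hio : i = o
  · simp [hio, ho, ho']
  · constructor <;> intro hi <;> by_contra hi'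
    · exact ((hr i).2.2 hio hi).ne' ((hs i).1 hi')
    · exact ((hs i).2.2 hio hi).ne' ((hr i).1 hi')

theorem exists_polynomial_cone (w : ι → Fin m → ℤ) (o : ι) :
    ∃ p : Polynomial ℤ, p.degree ≤ m ∧
      (p : PowerSeries ℤ) = (1 - X) ^ (m + 1) * levelSeries w fun _ a => 0 ≤ a := by
  classical
  let l : List ι := o :: Finset.univ.toList
  have hl : ∀ i, i ∈ l := fun i => by simp [l]
  let F : Finset (Finset ι) := Finset.univ.filter fun τ => o ∈ τ ∧ IsFace w l τ
  have hF : ∀ τ ∈ F, o ∈ τ ∧ IsFace w l τ := fun τ hτ => by simpa [F] using hτ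
  have hseries : levelSeries w (fun _ a => 0 ≤ a) = ∑ τ ∈ F, levelSeries w (HalfOpen τ o) := by
    ext k
    rw [map_sum]
    simp only [levelSeries, coeff_mk]
    have hunion : level w (fun _ a => 0 ≤ a) k = ⋃ τ ∈ (F : Set (Finset ι)),
        level w (HalfOpen τ o) k := by
      ext v
      simp only [Set.mem_iUnion]
      constructor
      · rintro ⟨s, hs, hsx⟩
        obtain ⟨τ, hτ, r, hr, hrx⟩ := exists_isFace w o Finset.univ.toList hs hsx
        exact ⟨τ, by simpa [F] using hτ, r, hr, hrx⟩
      · rintro ⟨τ, -, r, hr, hrx⟩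
        exact ⟨r, fun i => (hr i).nonneg, hrx⟩
    rw [hunion, F.finite_toSet.ncard_biUnion
      (fun τ _ => level_finite w (fun i a h => h.nonneg) k), finsum_mem_coe_finset, Nat.cast_sum]
    intro τ hτ τ' hτ' hne
    refine Set.disjoint_left.2 ?_
    rintro v ⟨r, hr, hrx⟩ ⟨s, hs, hsx⟩
    obtain ⟨ho, hf⟩ := hF τ hτ
    obtain ⟨ho', hf'⟩ := hF τ' hτ'
    exact hne (hf.unique hl ho ho' hf' hr hs (hrx.trans hsx.symm))
  have hface : ∀ τ ∈ F, ∃ p : Polynomial ℤ, p.degree ≤ m ∧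
      (p : PowerSeries ℤ) = (1 - X) ^ (m + 1) * levelSeries w (HalfOpen τ o) := by
    intro τ hτ
    obtain ⟨ho, hf⟩ := hF τ hτ
    have hind : ∀ r : ι → ℝ, (∀ i ∉ τ, r i = 0) → coneMap w r = 0 → r = 0 := fun r h0 hr =>
      hf.eq_zero hl hf hr (fun i hi => (h0 i hi).ge) fun i hi => (h0 i hi).le
    obtain ⟨p, hp, hpe⟩ := exists_polynomial_halfOpen w ho hind
    have hcard := card_le_of_coneMap_injective w hind
    have hpos : 0 < τ.card := Finset.card_pos.2 ⟨o, ho⟩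
    refine ⟨(1 - Polynomial.X) ^ (m + 1 - τ.card) * p, ?_, ?_⟩
    · have h1 : (1 - Polynomial.X : Polynomial ℤ).natDegree ≤ 1 := by compute_degree
      have h2 : p.natDegree ≤ τ.card - 1 := by
        rcases eq_or_ne p 0 with rfl | hp0
        · simp
        · exact Nat.le_sub_one_of_lt ((Polynomial.natDegree_lt_iff_degree_lt hp0).2 hp)
      refine Polynomial.natDegree_le_iff_degree_le.1 (Polynomial.natDegree_mul_le.trans ?_)
      have h3 := Polynomial.natDegree_pow_le_of_le (m + 1 - τ.card) h1
      omega
    · have hm : m + 1 = m + 1 - τ.card + τ.card := by omega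
      conv_rhs => rw [hm, pow_add, mul_assoc, ← hpe]
      simp
  choose! p hp hpe using hface
  refine ⟨∑ τ ∈ F, p τ, (Polynomial.degree_sum_le _ _).trans (Finset.sup_le hp), ?_⟩
  rw [hseries, Finset.mul_sum, ← Finset.sum_congr rfl hpe]
  exact map_sum (Polynomial.coeToPowerSeries.ringHom (R := ℤ)) _ _

end Cone

theorem mem_smul_convexHull_iff {m : ℕ} {S : Finset (Fin m → ℤ)} (hS : S.Nonempty)
    (x : Fin m → ℝ) (k : ℕ) :
    x ∈ (k : ℝ) • convexHull ℝ
      ((fun v : Fin m → ℤ => fun i => (v i : ℝ)) '' (S : Set (Fin m → ℤ))) ↔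
      ∃ r : S → ℝ, (∀ i, 0 ≤ r i) ∧
        coneMap (fun v : S => (v : Fin m → ℤ)) r = (x, (k : ℝ)) := by
  classical
  let g : S → Fin m → ℝ := fun v i => ((v : Fin m → ℤ) i : ℝ)
  have himg : (fun v : Fin m → ℤ => fun i => (v i : ℝ)) '' (S : Set (Fin m → ℤ)) =
      Fintype.linearCombination ℝ g '' Set.range fun i : S => (Pi.single i 1 : S → ℝ) := by
    rw [Set.image_eq_range, ← Set.range_comp]
    congr 1
    ext v i
    simp [g]
  have hg : ∀ r : S → ℝ, ∀ k : ℝ, coneMap (fun v : S => (v : Fin m → ℤ)) r = (x, k) ↔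
      Fintype.linearCombination ℝ g r = x ∧ ∑ i, r i = k := by
    intro r k
    rw [coneMap_eq_iff]
    simp [Fintype.linearCombination_apply, funext_iff, g]
  rw [himg, ← LinearMap.image_convexHull, convexHull_rangle_single_eq_stdSimplex,
    Set.mem_smul_set]
  simp only [hg]
  constructor
  · rintro ⟨_, ⟨r, hr, rfl⟩, rfl⟩
    refine ⟨(k : ℝ) • r, fun i => mul_nonneg k.cast_nonneg (hr.1 i), map_smul _ _ _, ?_⟩
    simp only [Pi.smul_apply, smul_eq_mul, ← Finset.mul_sum, hr.2, mul_one]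
  · rintro ⟨r, hr, hx, hk⟩
    suffices ∃ t ∈ stdSimplex ℝ S, (k : ℝ) • t = r by
      obtain ⟨t, ht, rfl⟩ := this
      exact ⟨_, ⟨t, ht, rfl⟩, by rw [← map_smul, hx]⟩
    rcases Nat.eq_zero_or_pos k with rfl | hpos
    · have h0 : r = 0 := by
        rw [Nat.cast_zero, Finset.sum_eq_zero_iff_of_nonneg fun i _ => hr i] at hk
        exact funext fun i => hk i (Finset.mem_univ i)
      obtain ⟨v, hv⟩ := hS
      exact ⟨Pi.single ⟨v, hv⟩ 1, single_mem_stdSimplex ℝ _, by simp [h0]⟩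
    · have hk0 : (0 : ℝ) < k := Nat.cast_pos.2 hpos
      refine ⟨(k : ℝ)⁻¹ • r, ⟨fun i => mul_nonneg (inv_nonneg.2 hk0.le) (hr i), ?_⟩, ?_⟩
      · simp only [Pi.smul_apply, smul_eq_mul, ← Finset.mul_sum, hk, inv_mul_cancel₀ hk0.ne']
      · simp [smul_smul, hk0.ne']

end Ehrhart

/-- For an integral polytope Δ ⊂ ℝ^m with nonempty interior, the product
(1 − t)^{m+1} · ∑_k #(kΔ ∩ ℤ^m) t^k is a polynomial of degree ≤ m; i.e. the lattice-point
generating series (the one-variable Hilbert series) is rational with denominator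
(1 − t)^{m+1}. -/
theorem ehrhart_series_rational (m : ℕ) (hm : 1 ≤ m) (S : Finset (Fin m → ℤ))
    (Δ : Set (Fin m → ℝ))
    (hΔ : Δ = convexHull ℝ ((fun v : Fin m → ℤ => fun i => (v i : ℝ)) '' (S : Set (Fin m → ℤ))))
    (hint : (interior Δ).Nonempty) :
    ∃ p : Polynomial ℤ, p.degree ≤ (m : ℕ) ∧
      (p : PowerSeries ℤ) =
        (1 - PowerSeries.X) ^ (m + 1) *
          PowerSeries.mk (fun k : ℕ =>
            (Set.ncard {v : Fin m → ℤ | (fun j => (v j : ℝ)) ∈ (k : ℝ) • Δ} : ℤ)) := by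
  have hS : S.Nonempty := by
    rw [Finset.nonempty_iff_ne_empty]
    rintro rfl
    simp [hΔ] at hint
  obtain ⟨v, hv⟩ := id hS
  obtain ⟨p, hp, hpe⟩ :=
    Ehrhart.exists_polynomial_cone (fun v : S => (v : Fin m → ℤ)) ⟨v, hv⟩
  refine ⟨p, hp, hpe.trans ?_⟩
  simp only [hΔ, Ehrhart.mem_smul_convexHull_iff hS]
  rfl
end

section
/- Let m ≥ 1 and let Δ ⊂ ℝ^m be an integral polytope, i.e. the convex hull of a finite subset of ℤ^m, and assume Δ has nonempty interior. Then for each coordinate index j ∈ {1,…,m} there exists a polynomial s_j with real coefficients, of degree at most m+1, whose coefficient of k^{m+1} equals the integral ∫_Δ x_j dx of the j-th coordinate function over Δ with respect to Lebesgue measure, and such that for every natural number i, s_j(i) = ∑_{a ∈ iΔ ∩ ℤ^m} a_j, the sum of the j-th coordinates of all lattice points of ℤ^m contained in iΔ. -/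
open Pointwise MeasureTheory

/-- `v` is nonzero and its first nonzero coordinate is negative. -/
def LexNeg {n : ℕ} (v : Fin n → ℝ) : Prop := ∃ k, v k < 0 ∧ ∀ i < k, v i = 0

lemma LexNeg.smul {n : ℕ} {v : Fin n → ℝ} (hv : LexNeg v) {c : ℝ} (hc : 0 < c) :
    LexNeg (c • v) := by
  obtain ⟨k, hk, h⟩ := hv
  exact ⟨k, mul_neg_of_pos_of_neg hc hk, fun i hi => by simp [h i hi]⟩

lemma eq_zero_of_not_lexNeg {n : ℕ} {v : Fin n → ℝ} (h₁ : ¬ LexNeg v) (h₂ : ¬ LexNeg (-v)) :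
    v = 0 := by
  by_contra hv
  obtain ⟨k, hk, hmin⟩ : ∃ k, v k ≠ 0 ∧ ∀ i < k, v i = 0 := by
    obtain ⟨k, hk⟩ := Function.ne_iff.1 hv
    obtain ⟨l, hl, hl'⟩ := WellFounded.has_min (wellFounded_lt (α := Fin n)) {k | v k ≠ 0} ⟨k, hk⟩
    exact ⟨l, hl, fun i hi => by_contra fun h => hl' i h hi⟩
  rcases lt_or_gt_of_ne hk with hk | hk
  · exact h₁ ⟨k, hk, hmin⟩
  · exact h₂ ⟨k, by simpa using hk, fun i hi => by simp [hmin i hi]⟩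

/-- A nonempty compact subset of `ℝⁿ` has a lexicographically least element. -/
lemma IsCompact.exists_forall_not_lexNeg_sub {n : ℕ} {K : Set (Fin n → ℝ)} (hK : IsCompact K)
    (hne : K.Nonempty) : ∃ x ∈ K, ∀ y ∈ K, ¬ LexNeg (y - x) := by
  induction n with
  | zero =>
    obtain ⟨x, hx⟩ := hne
    exact ⟨x, hx, fun y _ ⟨k, _⟩ => k.elim0⟩
  | succ n ih =>
    obtain ⟨x₀, hx₀, hmin⟩ := hK.exists_isMinOn hne (continuous_apply 0).continuousOn
    have hK₀ : IsCompact (Fin.tail '' (K ∩ {x | x 0 = x₀ 0})) :=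
      (hK.inter_right (isClosed_eq (continuous_apply 0) continuous_const)).image
        (continuous_pi fun i => continuous_apply i.succ)
    obtain ⟨_, ⟨x, ⟨hx, hxx⟩, rfl⟩, hlex⟩ := ih hK₀ ⟨_, x₀, ⟨hx₀, rfl⟩, rfl⟩
    have hxx : x 0 = x₀ 0 := hxx
    refine ⟨x, hx, fun y hy ⟨k, hk, hz⟩ => ?_⟩
    have hle : x₀ 0 ≤ y 0 := hmin hy
    induction k using Fin.cases with
    | zero =>
      have : y 0 - x 0 < 0 := hk
      linarith
    | succ k =>
      have h0 : y 0 - x 0 = 0 := hz 0 (Fin.succ_pos k)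
      refine hlex _ ⟨y, ⟨hy, ?_⟩, rfl⟩ ⟨k, hk, fun i hi => hz i.succ (Fin.succ_lt_succ_iff.2 hi)⟩
      show y 0 = x₀ 0
      linarith

section Support

variable {n : ℕ} {W : Type*} [AddCommGroup W] [Module ℝ W] (L : (Fin n → ℝ) →ₗ[ℝ] W)

/-- `T` is the support of lexicographically least points of the fibres of `L` on the
nonnegative orthant. -/
def IsLexSupport (T : Finset (Fin n)) : Prop :=
  ∀ v, L v = 0 → (∀ t ∉ T, 0 ≤ v t) → ¬ LexNeg v

/-- The support of a nonnegative vector. -/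
noncomputable def posSupport (x : Fin n → ℝ) : Finset (Fin n) := {t | 0 < x t}

@[simp] lemma mem_posSupport {x : Fin n → ℝ} {t : Fin n} : t ∈ posSupport x ↔ 0 < x t := by
  simp [posSupport]

variable {L}

lemma isLexSupport_posSupport {x : Fin n → ℝ} (hx : 0 ≤ x)
    (hmin : ∀ y, 0 ≤ y → L y = L x → ¬ LexNeg (y - x)) : IsLexSupport L (posSupport x) := by
  intro v hv hpos hneg
  obtain ⟨c, hc, hcx⟩ : ∃ c : ℝ, 0 < c ∧ 0 ≤ x + c • v := by
    have key : ∀ t, ∀ᶠ c : ℝ in nhdsWithin 0 (Set.Ioi 0), 0 ≤ x t + c * v t := by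
      intro t
      by_cases ht : 0 < x t
      · have : Filter.Tendsto (fun c : ℝ => x t + c * v t) (nhdsWithin 0 (Set.Ioi 0))
            (nhds (x t + 0 * v t)) :=
          (Continuous.tendsto (by fun_prop) 0).mono_left nhdsWithin_le_nhds
        filter_upwards [this.eventually (lt_mem_nhds (by simpa using ht))] with c hc using hc.le
      · filter_upwards [self_mem_nhdsWithin] with c hc
        exact add_nonneg (hx t) (mul_nonneg (le_of_lt hc) (hpos t (by simpa using ht)))
    obtain ⟨c, h₁, h₂⟩ := ((Filter.eventually_all.2 key).and self_mem_nhdsWithin).exists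
    exact ⟨c, h₂, h₁⟩
  refine hmin _ hcx (by simp [hv]) ?_
  simpa using hneg.smul hc

lemma IsLexSupport.eq_of_map_eq {x y : Fin n → ℝ} (hx : 0 ≤ x) (hy : 0 ≤ y)
    (hxs : IsLexSupport L (posSupport x)) (hys : IsLexSupport L (posSupport y))
    (h : L x = L y) : x = y := by
  have aux : ∀ {x y : Fin n → ℝ}, 0 ≤ x → 0 ≤ y → IsLexSupport L (posSupport x) → L x = L y →
      ¬ LexNeg (y - x) := by
    intro x y hx hy hs h
    refine hs _ (by simp [h]) fun t ht => ?_
    have := hx t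
    have := hy t
    simp only [mem_posSupport, not_lt] at ht
    simp only [Pi.sub_apply, Pi.zero_apply] at *
    linarith
  refine (sub_eq_zero.1 (eq_zero_of_not_lexNeg (aux hx hy hxs h) ?_)).symm
  simpa using aux hy hx hys h.symm

lemma exists_isLexSupport {w : W} (hK : IsCompact {x | 0 ≤ x ∧ L x = w}) {y : Fin n → ℝ}
    (hy : 0 ≤ y) (hyw : L y = w) :
    ∃ x, 0 ≤ x ∧ L x = w ∧ IsLexSupport L (posSupport x) := by
  obtain ⟨x, ⟨hx, hxw⟩, hmin⟩ := hK.exists_forall_not_lexNeg_sub ⟨y, hy, hyw⟩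
  exact ⟨x, hx, hxw, isLexSupport_posSupport hx fun z hz h => hmin z ⟨hz, h.trans hxw⟩⟩

end Support

section Antidiag

variable {ι : Type*} [DecidableEq ι]

lemma Finset.card_piAntidiag_nat (T : Finset ι) (hT : T.Nonempty) (N : ℕ) :
    (T.piAntidiag N).card = (N + T.card - 1).choose (T.card - 1) := by
  have h := card_finsuppAntidiag_nat_eq_choose (s := T) N
  have hc := hT.card_pos
  rw [← Nat.choose_symm_of_eq_add (show N + T.card - 1 = N + (T.card - 1) by omega)]
  simp [finsuppAntidiag] at h
  rw [h]
  congr 1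
  omega

lemma Finset.card_mul_sum_piAntidiag_apply (T : Finset ι) (N : ℕ) {t : ι} (ht : t ∈ T) :
    T.card * ∑ f ∈ T.piAntidiag N, f t = N * (T.piAntidiag N).card := by
  have key : ∀ u ∈ T, ∑ f ∈ T.piAntidiag N, f u = ∑ f ∈ T.piAntidiag N, f t := by
    intro u hu
    have hmem : ∀ f ∈ T.piAntidiag N, f ∘ Equiv.swap u t ∈ T.piAntidiag N := by
      intro f hf
      rw [mem_piAntidiag] at hf ⊢
      have hsw : ∀ i, Equiv.swap u t i ∈ T ↔ i ∈ T := by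
        intro i
        rw [Equiv.swap_apply_def]
        split_ifs <;> simp_all
      refine ⟨?_, fun i hi => (hsw i).1 (hf.2 _ hi)⟩
      rw [← hf.1]
      exact Finset.sum_equiv (Equiv.swap u t) (by simp [hsw]) (by simp)
    refine Finset.sum_nbij' (· ∘ Equiv.swap u t) (· ∘ Equiv.swap u t) hmem hmem ?_ ?_ ?_ <;>
      intros <;> simp [Function.comp_assoc, ← Equiv.coe_trans]
  calc T.card * ∑ f ∈ T.piAntidiag N, f t = ∑ u ∈ T, ∑ f ∈ T.piAntidiag N, f u := by
        rw [Finset.sum_congr rfl key, Finset.sum_const, smul_eq_mul]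
    _ = ∑ f ∈ T.piAntidiag N, ∑ u ∈ T, f u := Finset.sum_comm
    _ = N * (T.piAntidiag N).card := by
        rw [Finset.sum_congr rfl fun f hf => (mem_piAntidiag.1 hf).1, Finset.sum_const,
          smul_eq_mul, mul_comm]

end Antidiag

section Polynomial

open Polynomial Finset

variable {ι : Type*} [DecidableEq ι]

/-- The contribution of a fixed fractional part `r` to the weighted lattice point count of the
dilations of an open simplex is a polynomial. -/
lemma exists_polynomial_eval_eq_sum_piAntidiag (T : Finset ι) (r c : ι → ℝ) (h : ℕ)
    (hr₀ : ∀ t ∈ T, 0 < r t) (hr₁ : ∀ t ∈ T, r t ≤ 1) (hr : ∑ t ∈ T, r t = h) :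
    ∃ s : ℝ[X], ∀ i : ℕ, s.eval (i : ℝ) =
      if h ≤ i then ∑ f ∈ T.piAntidiag (i - h), ∑ t ∈ T, (f t + r t) * c t else 0 := by
  rcases T.eq_empty_or_nonempty with rfl | hT
  · exact ⟨0, by simp⟩
  obtain ⟨q, hq⟩ : ∃ q, T.card = q + 1 := ⟨T.card - 1, by have := hT.card_pos; omega⟩
  have hqr : (T.card : ℝ) = q + 1 := by rw [hq]; push_cast; rfl
  refine ⟨C ((q.factorial : ℝ)⁻¹) * (∏ l ∈ range q, (X - C (h : ℝ) + C (l + 1 : ℝ))) *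
    (C (∑ t ∈ T, r t * c t) + C ((∑ t ∈ T, c t) / (q + 1)) * (X - C (h : ℝ))), fun i => ?_⟩
  simp only [eval_mul, eval_C, eval_prod, eval_add, eval_sub, eval_X]
  split_ifs with hi
  · obtain ⟨N, rfl⟩ := Nat.exists_eq_add_of_le hi
    have hcard : ((T.piAntidiag N).card : ℝ) =
        (q.factorial : ℝ)⁻¹ * ∏ l ∈ range q, (N + (l + 1) : ℝ) := by
      have h1 := Nat.ascFactorial_eq_factorial_mul_choose N q
      rw [Nat.ascFactorial_eq_prod_range] at h1
      rw [card_piAntidiag_nat T hT, hq, show N + (q + 1) - 1 = N + q by omega,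
        Nat.add_sub_cancel, eq_inv_mul_iff_mul_eq₀ (by positivity)]
      rw [← Nat.cast_mul, ← h1]
      push_cast
      exact prod_congr rfl fun l _ => by ring
    have hsum : ∀ t ∈ T, ∑ f ∈ T.piAntidiag N, (f t : ℝ) =
        (T.piAntidiag N).card * (N / (q + 1)) := by
      intro t ht
      have h1 := congrArg (Nat.cast (R := ℝ)) (card_mul_sum_piAntidiag_apply T N ht)
      push_cast [hq] at h1
      field_simp
      linarith
    rw [sum_comm, Nat.add_sub_cancel_left]
    push_cast
    simp only [add_sub_cancel_left]
    rw [← hcard, mul_add, mul_sum, sum_div, sum_mul, mul_sum, ← sum_add_distrib]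
    refine sum_congr rfl fun t ht => ?_
    rw [← sum_mul, sum_add_distrib, hsum t ht, sum_const, nsmul_eq_mul]
    ring
  · have hle : h ≤ q + 1 := by
      have : ∑ t ∈ T, r t ≤ ∑ t ∈ T, 1 := sum_le_sum hr₁
      rw [hr, sum_const, hq] at this
      exact_mod_cast (by simpa using this : (h : ℝ) ≤ q + 1)
    by_cases hz : h - i ≤ q
    · rw [prod_eq_zero (mem_range.2 (show h - i - 1 < q by omega))]
      · simp
      · have : ((h - i - 1 : ℕ) : ℝ) = h - i - 1 := by
          rw [Nat.cast_sub (by omega), Nat.cast_sub (by omega)]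
          simp
        rw [this]
        ring
    · obtain rfl : i = 0 := by omega
      obtain rfl : h = q + 1 := by omega
      have hr_eq : ∀ t ∈ T, 1 - r t = 0 := by
        rw [← sum_eq_zero_iff_of_nonneg fun t ht => sub_nonneg.2 (hr₁ t ht), sum_sub_distrib, hr]
        simp [hq]
      have : ∑ t ∈ T, r t * c t = ∑ t ∈ T, c t :=
        sum_congr rfl fun t ht => by rw [← sub_eq_zero.1 (hr_eq t ht), one_mul]
      rw [this]
      have : (q : ℝ) + 1 ≠ 0 := by positivity
      push_cast
      field_simp
      ring

/-- A polynomial growing like `c * x ^ d` along the naturals has degree at most `d`, and `c` is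
its coefficient of degree `d`. -/
lemma Polynomial.degree_le_and_coeff_eq_of_tendsto {s : ℝ[X]} {d : ℕ} {c : ℝ}
    (h : Filter.Tendsto (fun i : ℕ => s.eval (i : ℝ) / (i : ℝ) ^ d) Filter.atTop (nhds c)) :
    s.degree ≤ d ∧ s.coeff d = c := by
  have hX : ∀ x : ℝ, ((X : ℝ[X]) ^ d).eval x = x ^ d := by simp
  have hdeg : s.degree ≤ d := by
    by_contra! hlt
    have := (abs_div_tendsto_atTop_atTop_of_degree_gt s (X ^ d) (by simpa using hlt)
      (pow_ne_zero _ X_ne_zero)).comp tendsto_natCast_atTop_atTop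
    simp only [hX] at this
    exact not_tendsto_nhds_of_tendsto_atTop this _ h.abs
  refine ⟨hdeg, ?_⟩
  rcases hdeg.eq_or_lt with heq | hlt
  · have := (div_tendsto_atTop_leadingCoeff_div_of_degree_eq s (X ^ d) (by simpa using heq)).comp
      tendsto_natCast_atTop_atTop
    simp only [hX] at this
    have h2 := tendsto_nhds_unique this h
    rw [← h2, leadingCoeff, natDegree_eq_of_degree_eq_some heq]
    simp
  · have := (div_tendsto_atTop_zero_of_degree_lt s (X ^ d) (by simpa using hlt)).comp
      tendsto_natCast_atTop_atTop
    simp only [hX] at this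
    rw [tendsto_nhds_unique h this, coeff_eq_zero_of_degree_lt hlt]

end Polynomial

section Lattice

variable {n m : ℕ} (p : Fin n → Fin m → ℤ)

/-- The linear map sending coefficients `x` to the point `∑ t, x t • (1, p t)` of the cone over
the polytope with vertices `p t`. -/
noncomputable def coneMap : (Fin n → ℝ) →ₗ[ℝ] ℝ × (Fin m → ℝ) :=
  Fintype.linearCombination ℝ fun t => ((1 : ℝ), fun j => (p t j : ℝ))

lemma coneMap_eq_iff (x : Fin n → ℝ) (c : ℝ) (v : Fin m → ℝ) :
    coneMap p x = (c, v) ↔ ∑ t, x t = c ∧ ∀ j, ∑ t, x t * p t j = v j := by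
  simp [coneMap, Fintype.linearCombination_apply, Prod.ext_iff, Prod.fst_sum, Prod.snd_sum,
    funext_iff]

lemma isCompact_setOf_nonneg_coneMap_eq (w : ℝ × (Fin m → ℝ)) :
    IsCompact {x | 0 ≤ x ∧ coneMap p x = w} := by
  have hcl : IsClosed {x | 0 ≤ x ∧ coneMap p x = w} :=
    (isClosed_le continuous_const continuous_id).inter
      (isClosed_eq (coneMap p).continuous_of_finiteDimensional continuous_const)
  refine (isCompact_Icc (a := (0 : Fin n → ℝ)) (b := fun _ => w.1)).of_isClosed_subset hcl ?_
  rintro x ⟨hx, hxw⟩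
  refine ⟨hx, fun t => ?_⟩
  rw [← ((coneMap_eq_iff p x w.1 w.2).1 hxw).1]
  exact Finset.single_le_sum (fun t _ => hx t) (Finset.mem_univ t)

/-- The possible fractional parts, in `(0, 1]` on the support, of the lexicographically least
coefficient vectors of lattice points. -/
def latticeBoxes : Set (Fin n → ℝ) :=
  {r | 0 ≤ r ∧ r ≤ 1 ∧ IsLexSupport (coneMap p) (posSupport r) ∧
    ∃ (h : ℕ) (a : Fin m → ℤ), coneMap p r = ((h : ℝ), fun j => (a j : ℝ))}

lemma finite_latticeBoxes : (latticeBoxes p).Finite := by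
  have hinj : Set.InjOn (coneMap p) (latticeBoxes p) := fun r hr s hs h =>
    hr.2.2.1.eq_of_map_eq hr.1 hs.1 hs.2.2.1 h
  refine Set.Finite.of_finite_image (Set.Finite.subset (((Set.finite_Iic n).prod (Set.finite_Icc
    (fun j => -∑ t, |p t j|) (fun j => ∑ t, |p t j|))).image
      fun w : ℕ × (Fin m → ℤ) => ((w.1 : ℝ), fun j => (w.2 j : ℝ))) ?_) hinj
  rintro _ ⟨r, ⟨hr₀, hr₁, -, h, a, hra⟩, rfl⟩
  obtain ⟨hs, ha⟩ := (coneMap_eq_iff p _ _ _).1 hra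
  have habs : ∀ j, |a j| ≤ ∑ t, |p t j| := by
    intro j
    have : |(a j : ℝ)| ≤ ∑ t, |(p t j : ℝ)| := by
      rw [← ha j]
      refine (Finset.abs_sum_le_sum_abs _ _).trans (Finset.sum_le_sum fun t _ => ?_)
      rw [abs_mul, abs_of_nonneg (hr₀ t)]
      exact mul_le_of_le_one_left (abs_nonneg _) (hr₁ t)
    exact_mod_cast this
  refine ⟨(h, a), ⟨?_, fun j => (abs_le.1 (habs j)).1, fun j => (abs_le.1 (habs j)).2⟩, hra.symm⟩
  have : ∑ t, r t ≤ ∑ _t : Fin n, (1 : ℝ) := Finset.sum_le_sum fun t _ => hr₁ t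
  rw [hs] at this
  simpa using this

lemma finsum_mem_eq_sum_latticeBoxes (j : Fin m) (i : ℕ) :
    ∑ᶠ v ∈ {v : Fin m → ℤ | ∃ x, 0 ≤ x ∧ coneMap p x = ((i : ℝ), fun j' => (v j' : ℝ))},
      (v j : ℝ) =
    ∑ r ∈ (finite_latticeBoxes p).toFinset, if ⌊∑ t, r t⌋₊ ≤ i then
      ∑ f ∈ (posSupport r).piAntidiag (i - ⌊∑ t, r t⌋₊),
        ∑ t ∈ posSupport r, (f t + r t) * (p t j : ℝ) else 0 := by
  classical
  set D : Finset (Σ _ : Fin n → ℝ, Fin n → ℕ) := (finite_latticeBoxes p).toFinset.sigma fun r =>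
    if ⌊∑ t, r t⌋₊ ≤ i then (posSupport r).piAntidiag (i - ⌊∑ t, r t⌋₊) else ∅ with hD
  have hmemD : ∀ r f, (⟨r, f⟩ : Σ _ : Fin n → ℝ, Fin n → ℕ) ∈ D ↔
      r ∈ latticeBoxes p ∧ ∑ t, (f t + r t) = i ∧ ∀ t, f t ≠ 0 → 0 < r t := by
    intro r f
    rw [hD, Finset.mem_sigma, Set.Finite.mem_toFinset]
    refine and_congr_right fun hr => ?_
    obtain ⟨-, -, -, h, a, hra⟩ := hr
    rw [Finset.sum_add_distrib, ((coneMap_eq_iff p _ _ _).1 hra).1, Nat.floor_natCast,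
      ← Nat.cast_sum, ← Nat.cast_add, Nat.cast_inj]
    have hsub : (∀ t, f t ≠ 0 → 0 < r t) → ∑ t ∈ posSupport r, f t = ∑ t, f t := fun hf =>
      Finset.sum_subset (Finset.subset_univ _) fun t _ ht => by
        by_contra h0
        exact ht (mem_posSupport.2 (hf t h0))
    split_ifs with hi
    · simp only [Finset.mem_piAntidiag, mem_posSupport]
      refine and_congr_left fun hf => ?_
      rw [hsub hf]
      omega
    · simp only [Finset.notMem_empty, false_iff, not_and]
      intro h
      omega
  have hmap : ∀ r f, (⟨r, f⟩ : Σ _ : Fin n → ℝ, Fin n → ℕ) ∈ D → ∃ v : Fin m → ℤ,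
      coneMap p (fun t => f t + r t) = ((i : ℝ), fun j' => (v j' : ℝ)) := by
    intro r f hrf
    obtain ⟨⟨-, -, -, h, a, hra⟩, hsum, -⟩ := (hmemD r f).1 hrf
    refine ⟨fun j' => ∑ t, f t * p t j' + a j', (coneMap_eq_iff p _ _ _).2 ⟨hsum, fun j' => ?_⟩⟩
    simp only [add_mul, Finset.sum_add_distrib, ((coneMap_eq_iff p _ _ _).1 hra).2 j']
    push_cast
    rfl
  have hsupp : ∀ r f, (⟨r, f⟩ : Σ _ : Fin n → ℝ, Fin n → ℕ) ∈ D →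
      (0 : Fin n → ℝ) ≤ (fun t => f t + r t) ∧ posSupport (fun t => f t + r t) = posSupport r ∧
      ∀ t, f t = ⌈f t + r t⌉₊ - 1 := by
    intro r f hrf
    obtain ⟨⟨hr₀, hr₁, -⟩, -, hf⟩ := (hmemD r f).1 hrf
    refine ⟨fun t => add_nonneg (Nat.cast_nonneg _) (hr₀ t), ?_, fun t => ?_⟩
    · ext t
      simp only [mem_posSupport]
      refine ⟨fun h => ?_, fun h => by positivity⟩
      by_contra hr
      have : f t = 0 := by_contra fun h0 => hr (hf t h0)
      rw [this, Nat.cast_zero, zero_add] at h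
      exact hr h
    · rcases (hr₀ t).eq_or_lt with h0 | h0
      · have h0 : 0 = r t := h0
        have : f t = 0 := by_contra fun h1 => (hf t h1).ne h0
        simp [this, ← h0]
      · have h0 : 0 < r t := h0
        have h1 : r t ≤ 1 := hr₁ t
        have : ⌈f t + r t⌉₊ = f t + 1 := by
          rw [Nat.ceil_eq_iff (by omega)]
          push_cast
          constructor <;> simp <;> linarith
        omega
  rw [← finsum_mem_eq_of_bijOn (s := (D : Set (Σ _ : Fin n → ℝ, Fin n → ℕ)))
    (f := fun d => ∑ t ∈ posSupport d.1, (d.2 t + d.1 t) * (p t j : ℝ))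
    (fun d j' => ⌊(coneMap p fun t => d.2 t + d.1 t).2 j'⌋)]
  · rw [finsum_mem_coe_finset, hD, Finset.sum_sigma]
    refine Finset.sum_congr rfl fun r _ => ?_
    split_ifs <;> simp
  · refine ⟨?_, ?_, ?_⟩
    · rintro ⟨r, f⟩ hrf
      obtain ⟨v, hv⟩ := hmap r f hrf
      exact ⟨_, (hsupp r f hrf).1, by simp [hv]⟩
    · rintro ⟨r, f⟩ hrf ⟨r', f'⟩ hrf' heq
      obtain ⟨v, hv⟩ := hmap r f hrf
      obtain ⟨v', hv'⟩ := hmap r' f' hrf'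
      simp only [hv, hv', Int.floor_intCast] at heq
      have heq : v = v' := heq
      obtain ⟨hx, hs, hf⟩ := hsupp r f hrf
      obtain ⟨hx', hs', hf'⟩ := hsupp r' f' hrf'
      have hr := ((hmemD r f).1 hrf).1.2.2.1
      have hr' := ((hmemD r' f').1 hrf').1.2.2.1
      have hxx := IsLexSupport.eq_of_map_eq hx hx' (hs ▸ hr) (hs' ▸ hr') (by rw [hv, hv', heq])
      have hff : f = f' := by
        ext t
        rw [hf t, hf' t, congrFun hxx t]
      subst hff
      have hrr : r = r' := by
        ext t
        have := congrFun hxx t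
        simpa using this
      rw [hrr]
    · rintro v ⟨y, hy, hyv⟩
      obtain ⟨x, hx, hxv, hxs⟩ :=
        exists_isLexSupport (isCompact_setOf_nonneg_coneMap_eq p _) hy hyv
      obtain ⟨hsum, hco⟩ := (coneMap_eq_iff p _ _ _).1 hxv
      set f : Fin n → ℕ := fun t => ⌈x t⌉₊ - 1 with hf
      set r : Fin n → ℝ := fun t => x t - f t with hr
      have hfr : (fun t => f t + r t) = x := by
        ext t
        simp [hr]
      have hcases : ∀ t, (x t = 0 ∧ f t = 0 ∧ r t = 0) ∨ (0 < x t ∧ 0 < r t ∧ r t ≤ 1) := by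
        intro t
        rcases (hx t).eq_or_lt with h0 | h0
        · have h0 : 0 = x t := h0
          left
          simp [hr, hf, ← h0]
        · have h0 : 0 < x t := h0
          right
          have h1 : (f t : ℝ) = ⌈x t⌉₊ - 1 := by
            rw [hf, Nat.cast_sub (Nat.ceil_pos.2 h0), Nat.cast_one]
          have h2 := Nat.le_ceil (x t)
          have h3 := Nat.ceil_lt_add_one h0.le
          simp only [hr, h1]
          exact ⟨h0, by linarith, by linarith⟩
      have hr₀ : 0 ≤ r := fun t => by
        rcases hcases t with h | h
        · exact h.2.2.ge
        · exact h.2.1.le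
      have hps : posSupport r = posSupport x := by
        ext t
        simp only [mem_posSupport]
        rcases hcases t with h | h
        · simp [h.1, h.2.2]
        · simp [h.1, h.2.1]
      have hri : ∑ t, r t = (i : ℝ) - (∑ t, f t : ℕ) := by
        simp [hr, Finset.sum_sub_distrib, hsum]
      have hle : ∑ t, f t ≤ i := by
        have : 0 ≤ ∑ t, r t := Finset.sum_nonneg fun t _ => hr₀ t
        rw [hri] at this
        exact_mod_cast sub_nonneg.1 this
      refine ⟨⟨r, f⟩, (hmemD r f).2 ⟨⟨hr₀, fun t => ?_, hps ▸ hxs, i - ∑ t, f t,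
        fun j' => v j' - ∑ t, f t * p t j', ?_⟩, ?_, fun t ht => ?_⟩, ?_⟩
      · rcases hcases t with h | h
        · simp [h.2.2]
        · exact h.2.2
      · rw [coneMap_eq_iff, hri, Nat.cast_sub hle]
        refine ⟨rfl, fun j' => ?_⟩
        simp [hr, sub_mul, Finset.sum_sub_distrib, hco]
      · rw [← hsum]
        exact Finset.sum_congr rfl fun t _ => congrFun hfr t
      · rcases hcases t with h | h
        · exact absurd h.2.1 ht
        · exact h.2.1
      · simp [hfr, hxv]
  · rintro ⟨r, f⟩ hrf
    obtain ⟨v, hv⟩ := hmap r f hrf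
    simp only [hv, Int.floor_intCast]
    rw [← ((coneMap_eq_iff p _ _ _).1 hv).2 j]
    refine Finset.sum_subset (Finset.subset_univ _) fun t _ ht => ?_
    rw [← (hsupp r f hrf).2.1, mem_posSupport, not_lt] at ht
    rw [le_antisymm ht ((hsupp r f hrf).1 t), zero_mul]

theorem exists_polynomial_eval_eq_finsum_mem (j : Fin m) : ∃ s : Polynomial ℝ, ∀ i : ℕ,
    s.eval (i : ℝ) =
      ∑ᶠ v ∈ {v : Fin m → ℤ | ∃ x, 0 ≤ x ∧ coneMap p x = ((i : ℝ), fun j' => (v j' : ℝ))},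
        (v j : ℝ) := by
  have key : ∀ r : Fin n → ℝ, ∃ s : Polynomial ℝ, r ∈ latticeBoxes p → ∀ i : ℕ,
      s.eval (i : ℝ) = if ⌊∑ t, r t⌋₊ ≤ i then
        ∑ f ∈ (posSupport r).piAntidiag (i - ⌊∑ t, r t⌋₊),
          ∑ t ∈ posSupport r, (f t + r t) * (p t j : ℝ) else 0 := by
    intro r
    by_cases hr : r ∈ latticeBoxes p
    · obtain ⟨hr₀, hr₁, -, h, a, hra⟩ := id hr
      have hsum := ((coneMap_eq_iff p _ _ _).1 hra).1
      rw [hsum, Nat.floor_natCast]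
      obtain ⟨s, hs⟩ := exists_polynomial_eval_eq_sum_piAntidiag (posSupport r) r
        (fun t => (p t j : ℝ)) h (fun t ht => mem_posSupport.1 ht) (fun t _ => hr₁ t) (by
          rw [← hsum]
          refine Finset.sum_subset (Finset.subset_univ _) fun t _ ht => ?_
          rw [mem_posSupport, not_lt] at ht
          exact le_antisymm ht (hr₀ t))
      exact ⟨s, fun _ => hs⟩
    · exact ⟨0, fun h => absurd h hr⟩
  choose s hs using key
  refine ⟨∑ r ∈ (finite_latticeBoxes p).toFinset, s r, fun i => ?_⟩
  rw [finsum_mem_eq_sum_latticeBoxes, Polynomial.eval_finsetSum]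
  exact Finset.sum_congr rfl fun r hr => hs r ((Set.Finite.mem_toFinset _).1 hr) i

lemma mem_smul_convexHull_range_iff (hn : 0 < n) (c : ℝ) (hc : 0 ≤ c) (v : Fin m → ℝ) :
    v ∈ c • convexHull ℝ (Set.range fun t j => (p t j : ℝ)) ↔
      ∃ x, 0 ≤ x ∧ coneMap p x = (c, v) := by
  classical
  have himg : convexHull ℝ (Set.range fun t j => (p t j : ℝ)) =
      Fintype.linearCombination ℝ (fun t j => (p t j : ℝ)) '' stdSimplex ℝ (Fin n) := by
    rw [← convexHull_rangle_single_eq_stdSimplex, LinearMap.image_convexHull, ← Set.range_comp]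
    congr 2
    ext t j
    simp [Fintype.linearCombination_apply_single]
  simp only [himg, Set.mem_smul_set, coneMap_eq_iff]
  constructor
  · rintro ⟨_, ⟨w, ⟨hw₀, hw₁⟩, rfl⟩, rfl⟩
    refine ⟨c • w, smul_nonneg hc hw₀, ?_, fun j => ?_⟩
    · simp [← Finset.mul_sum, hw₁]
    · simp [Fintype.linearCombination_apply, Finset.mul_sum, mul_assoc]
  · rintro ⟨x, hx, hsum, hv⟩
    rcases hc.eq_or_lt with rfl | hc
    · have hx0 : ∀ t, x t = 0 := fun t =>
        (Finset.sum_eq_zero_iff_of_nonneg fun t _ => hx t).1 hsum t (Finset.mem_univ t)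
      refine ⟨_, ⟨Pi.single ⟨0, hn⟩ 1, single_mem_stdSimplex ℝ _, rfl⟩, ?_⟩
      ext j
      simp [← hv, hx0]
    · refine ⟨_, ⟨c⁻¹ • x, ⟨fun t => mul_nonneg (inv_nonneg.2 hc.le) (hx t), ?_⟩, rfl⟩, ?_⟩
      · simp [← Finset.mul_sum, hsum, hc.ne']
      · ext j
        simp [Fintype.linearCombination_apply, ← hv, Finset.mul_sum, hc.ne']

end Lattice

/-- The normalised sums of a coordinate over the lattice points of the dilations of a bounded set
converge to the integral of that coordinate over the set. -/
lemma tendsto_finsum_mem_smul_div_pow {m : ℕ} (Δ : Set (Fin m → ℝ)) (hb : Bornology.IsBounded Δ)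
    (hm : MeasurableSet Δ) (hf : volume (frontier Δ) = 0) (j : Fin m) :
    Filter.Tendsto (fun i : ℕ =>
      (∑ᶠ v ∈ {v : Fin m → ℤ | (fun j' => (v j' : ℝ)) ∈ (i : ℝ) • Δ}, (v j : ℝ)) /
        (i : ℝ) ^ (m + 1)) Filter.atTop (nhds (∫ x in Δ, x j)) := by
  refine (tendsto_tsum_div_pow_atTop_integral Δ (fun x => x j) (continuous_apply j) hb hm
    hf).congr' ?_
  filter_upwards [Filter.eventually_gt_atTop 0] with i hi
  have : NeZero i := ⟨hi.ne'⟩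
  have hi : (i : ℝ) ≠ 0 := Nat.cast_ne_zero.2 hi.ne'
  set A : Set (Fin m → ℝ) :=
    Δ ∩ (i : ℝ)⁻¹ • (Submodule.span ℤ (Set.range (Pi.basisFun ℝ (Fin m))) : Set (Fin m → ℝ))
  have hmem : ∀ x, x ∈ A ↔ x ∈ Δ ∧ ∀ l, ∃ a : ℤ, (a : ℝ) = i * x l := fun x =>
    and_congr_right fun _ => BoxIntegral.unitPartition.mem_smul_span_iff
  set B := {v : Fin m → ℤ | (fun j' => (v j' : ℝ)) ∈ (i : ℝ) • Δ}
  have hbij : Set.BijOn (fun (v : Fin m → ℤ) => (i : ℝ)⁻¹ • fun j' => (v j' : ℝ)) B A := by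
    refine ⟨fun v hv => (hmem _).2 ⟨(Set.mem_smul_set_iff_inv_smul_mem₀ hi _ _).1 hv,
      fun l => ⟨v l, by simp [hi]⟩⟩, fun v _ v' _ h => ?_, fun x hx => ?_⟩
    · ext l
      simpa [hi] using congrFun h l
    · obtain ⟨hxΔ, ha⟩ := (hmem x).1 hx
      choose a ha using ha
      have hax : (fun l => (a l : ℝ)) = (i : ℝ) • x := funext ha
      refine ⟨a, ?_, by simp [hax, hi]⟩
      show (fun l => (a l : ℝ)) ∈ (i : ℝ) • Δ
      rw [hax]
      exact Set.smul_mem_smul_set hxΔ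
  have hfin : B.Finite := by
    have : Set.InjOn (fun (v : Fin m → ℤ) => (fun j' => (v j' : ℝ))) B := fun v _ v' _ h => by
      ext l
      simpa using congrFun h l
    refine Set.Finite.of_finite_image ((ZSpan.setFinite_inter (Pi.basisFun ℝ (Fin m))
      (hb.smul₀ (i : ℝ))).subset ?_) this
    rintro _ ⟨v, hv, rfl⟩
    exact ⟨hv, ((Pi.basisFun ℝ (Fin m)).mem_span_iff_repr_mem ℤ _).2 fun l => ⟨v l, by simp⟩⟩
  have hAfin : A.Finite := hbij.image_eq ▸ hfin.image _
  have : Finite A := hAfin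
  rw [tsum_eq_finsum (Set.toFinite _), finsum_set_coe_eq_finsum_mem (f := fun x => x j) A,
    ← finsum_mem_eq_of_bijOn (f := fun v => (i : ℝ)⁻¹ * v j) _ hbij (fun v _ => rfl),
    ← mul_finsum_mem, Fintype.card_fin, inv_mul_eq_div, div_div, ← pow_succ']
  rfl

/-- For an integral polytope Δ ⊂ ℝ^m with nonempty interior and each
coordinate j, there is a polynomial s_j of degree ≤ m+1 whose coefficient of k^{m+1}
is ∫_Δ x_j dx and with s_j(i) = ∑_{a ∈ iΔ ∩ ℤ^m} a_j for every natural number i. -/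
theorem lattice_coordinate_sum_polynomial (m : ℕ) (hm : 1 ≤ m) (S : Finset (Fin m → ℤ))
    (Δ : Set (Fin m → ℝ))
    (hΔ : Δ = convexHull ℝ ((fun v : Fin m → ℤ => fun i => (v i : ℝ)) '' (S : Set (Fin m → ℤ))))
    (hint : (interior Δ).Nonempty) (j : Fin m) :
    ∃ s : Polynomial ℝ,
      s.degree ≤ (m + 1 : ℕ) ∧
      s.coeff (m + 1) = ∫ x in Δ, x j ∧
      ∀ i : ℕ, s.eval (i : ℝ) =
        ∑ᶠ v ∈ {v : Fin m → ℤ | (fun j' => (v j' : ℝ)) ∈ (i : ℝ) • Δ}, (v j : ℝ) := by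
  have hfin := S.finite_toSet.image fun v : Fin m → ℤ => fun i => (v i : ℝ)
  set p : Fin S.card → Fin m → ℤ := fun t => S.equivFin.symm t
  have hS : 0 < S.card := by
    rw [Finset.card_pos, Finset.nonempty_iff_ne_empty]
    rintro rfl
    simp [hΔ] at hint
  have hp : Δ = convexHull ℝ (Set.range fun t j => (p t j : ℝ)) := by
    rw [hΔ]
    congr 1
    ext x
    constructor
    · rintro ⟨v, hv, rfl⟩
      exact ⟨S.equivFin ⟨v, hv⟩, by simp [p]⟩
    · rintro ⟨t, rfl⟩
      exact ⟨p t, (S.equivFin.symm t).2, rfl⟩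
  obtain ⟨s, hs⟩ := exists_polynomial_eval_eq_finsum_mem p j
  simp only [← mem_smul_convexHull_range_iff p hS _ (Nat.cast_nonneg _), ← hp] at hs
  have hcompact : IsCompact Δ := by
    rw [hΔ]
    exact hfin.isCompact_convexHull ℝ
  have hconvex : Convex ℝ Δ := hΔ ▸ convex_convexHull ℝ _
  have hlim := tendsto_finsum_mem_smul_div_pow Δ hcompact.isBounded hcompact.measurableSet
    (hconvex.addHaar_frontier volume) j
  simp only [← hs] at hlim
  obtain ⟨hdeg, hcoeff⟩ := Polynomial.degree_le_and_coeff_eq_of_tendsto hlim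
  exact ⟨s, hdeg, hcoeff, hs⟩
end
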